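/- For every integer n ≥ 16, the path Pₙ is the unique minimizer of λ₁(T) + λ₂(T) among all trees T on n vertices; that is, every tree T on n vertices not isomorphic to Pₙ satisfies λ₁(T) + λ₂(T) > λ₁(Pₙ) + λ₂(Pₙ). -/

import Mathlib

open scoped Classical

/-- Adjacency matrix of a simple graph on `Fin n`, over `ℝ`. -/
noncomputable def adjMat {n : ℕ} (G : SimpleGraph (Fin n)) : Matrix (Fin n) (Fin n) ℝ :=
  fun i j => if G.Adj i j then 1 else 0

/-- The eigenvalues (roots of the characteristic polynomial, with multiplicity)
of the adjacency matrix, sorted in nondecreasing order. -/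
noncomputable def eigList {n : ℕ} (G : SimpleGraph (Fin n)) : List ℝ :=
  (Matrix.charpoly (adjMat G)).roots.sort (· ≤ ·)

/-- `lam k G` is the `k`-th largest adjacency eigenvalue of `G` (so `lam 1` is `λ₁`). -/
noncomputable def lam {n : ℕ} (k : ℕ) (G : SimpleGraph (Fin n)) : ℝ :=
  (eigList G).getD (n - k) 0

/-- The double comet `DC(k1, k2, l)`: a path on `l` vertices (the vertices `0, …, l-1`),
with `k1` pendant leaves attached to the terminal vertex `0` and `k2` pendant leaves
attached to the terminal vertex `l - 1`. -/
def doubleComet (k1 k2 l : ℕ) : SimpleGraph (Fin (k1 + k2 + l)) :=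
  SimpleGraph.fromRel (fun i j =>
    ((i : ℕ) + 1 = (j : ℕ) ∧ (j : ℕ) < l) ∨
    (l ≤ (i : ℕ) ∧ (i : ℕ) < l + k1 ∧ (j : ℕ) = 0) ∨
    (l + k1 ≤ (i : ℕ) ∧ (j : ℕ) = l - 1))

/-- Degree of a vertex. -/
noncomputable def deg {n : ℕ} (G : SimpleGraph (Fin n)) (u : Fin n) : ℕ :=
  (Finset.univ.filter (fun w => G.Adj u w)).card

open Matrix Finset

lemma adjMat_isHermitian {n : ℕ} (G : SimpleGraph (Fin n)) : (adjMat G).IsHermitian := by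
  ext i j
  simp [adjMat, Matrix.conjTranspose, SimpleGraph.adj_comm]

lemma eigList_eq {n : ℕ} (G : SimpleGraph (Fin n)) :
    eigList G = (List.ofFn (adjMat_isHermitian G).eigenvalues₀).reverse := by
  have h := (adjMat_isHermitian G).roots_charpoly_eq_eigenvalues₀
  unfold eigList
  apply List.Perm.eq_of_pairwise' (r := (· ≤ ·))
  · exact Multiset.pairwise_sort _ _
  · rw [List.pairwise_reverse, List.pairwise_ofFn]
    intro i j hij
    exact (adjMat_isHermitian G).eigenvalues₀_antitone hij.le
  · rw [← Multiset.coe_eq_coe, Multiset.sort_eq, h, Multiset.coe_reverse]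
    simp [List.ofFn_eq_map, Fin.univ_val_map]

lemma lam_eq {n : ℕ} (G : SimpleGraph (Fin n)) (k : ℕ) (hk : k < n) :
    lam (k+1) G = (adjMat_isHermitian G).eigenvalues₀ ⟨k, by simpa using hk⟩ := by
  unfold lam
  rw [eigList_eq, List.getD_eq_getElem _ _ (by simp; omega)]
  simp only [List.getElem_reverse, List.getElem_ofFn, List.length_ofFn, Fintype.card_fin]
  congr 1
  apply Fin.ext
  simp
  omega

/-- the key spectral inequality -/
lemma spectral_key {n : ℕ} (hn : 2 ≤ n) (G : SimpleGraph (Fin n)) :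
    lam 2 G ≤ lam 1 G ∧ ∃ e : Fin n → ℝ, e ⬝ᵥ e = 1 ∧
      ∀ x : Fin n → ℝ, x ⬝ᵥ (adjMat G *ᵥ x) ≤
        lam 2 G * (x ⬝ᵥ x) + (lam 1 G - lam 2 G) * (x ⬝ᵥ e)^2 := by
  set hA := adjMat_isHermitian G with hAdef
  have l1 := lam_eq G 0 (by omega)
  have l2 := lam_eq G 1 (by omega)
  simp only [zero_add, Nat.reduceAdd] at l1 l2
  have hanti := hA.eigenvalues₀_antitone
  have h21 : lam 2 G ≤ lam 1 G := by
    rw [l1, l2]; apply hanti; simp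
  refine ⟨h21, ?_⟩
  set b := hA.eigenvectorBasis with hb
  set eqv := (Fintype.equivOfCardEq (Fintype.card_fin (Fintype.card (Fin n))) : Fin (Fintype.card (Fin n)) ≃ Fin n) with heqv
  set i0 : Fin n := eqv ⟨0, by simp; omega⟩ with hi0
  have hev : ∀ i, hA.eigenvalues i = hA.eigenvalues₀ (eqv.symm i) := fun i => rfl
  have e1 : hA.eigenvalues i0 = lam 1 G := by rw [hev, l1, hi0, Equiv.symm_apply_apply]
  have e2 : ∀ i, i ≠ i0 → hA.eigenvalues i ≤ lam 2 G := by
    intro i hi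
    rw [hev, l2]
    apply hanti
    have : eqv.symm i ≠ ⟨0, by simp; omega⟩ := by
      intro h; apply hi; rw [hi0, ← h, Equiv.apply_symm_apply]
    rw [Fin.le_def]
    have : (eqv.symm i).val ≠ 0 := fun h => this (Fin.ext h)
    simp; omega
  have hin : ∀ x y : Fin n → ℝ, x ⬝ᵥ y = inner ℝ (WithLp.toLp 2 x) (WithLp.toLp 2 y) := by
    intro x y
    simp [PiLp.inner_apply, dotProduct, mul_comm]
  have hpars : ∀ x y : Fin n → ℝ, x ⬝ᵥ y = ∑ i, (x ⬝ᵥ (b i).ofLp) * (y ⬝ᵥ (b i).ofLp) := by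
    intro x y
    rw [hin, ← b.sum_inner_mul_inner]
    refine Finset.sum_congr rfl fun i _ => ?_
    rw [hin, hin]
    congr 1
    rw [real_inner_comm]
  have hAx : ∀ (x : Fin n → ℝ) i, (adjMat G *ᵥ x) ⬝ᵥ (b i).ofLp = hA.eigenvalues i * (x ⬝ᵥ (b i).ofLp) := by
    intro x i
    have h1 := hA.mulVec_eigenvectorBasis i
    have hsym : (adjMat G)ᵀ = adjMat G := by
      have := hA.eq; simpa [Matrix.conjTranspose_eq_transpose_of_trivial] using this
    rw [← Matrix.vecMul_transpose, hsym, ← Matrix.dotProduct_mulVec, h1, dotProduct_smul, smul_eq_mul]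
  refine ⟨(b i0).ofLp, ?_, ?_⟩
  · rw [hin]
    have := b.orthonormal.1 i0
    simp [this]
  · intro x
    have q1 : x ⬝ᵥ (adjMat G *ᵥ x) = ∑ i, hA.eigenvalues i * (x ⬝ᵥ (b i).ofLp)^2 := by
      rw [hpars]
      refine Finset.sum_congr rfl fun i _ => ?_
      rw [hAx]; ring
    have q2 : x ⬝ᵥ x = ∑ i, (x ⬝ᵥ (b i).ofLp)^2 := by
      rw [hpars]
      refine Finset.sum_congr rfl fun i _ => ?_
      ring
    rw [q1, q2, Finset.mul_sum, ← Finset.add_sum_erase _ _ (mem_univ i0),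
      ← Finset.add_sum_erase univ (fun i => lam 2 G * (x ⬝ᵥ (b i).ofLp)^2) (mem_univ i0), e1]
    have : ∑ i ∈ univ.erase i0, hA.eigenvalues i * (x ⬝ᵥ (b i).ofLp)^2 ≤
        ∑ i ∈ univ.erase i0, lam 2 G * (x ⬝ᵥ (b i).ofLp)^2 := by
      refine Finset.sum_le_sum fun i hi => ?_
      exact mul_le_mul_of_nonneg_right (e2 i (Finset.ne_of_mem_erase hi)) (sq_nonneg _)
    linarith

lemma dot_sq_le {n : ℕ} (x e : Fin n → ℝ) (he : e ⬝ᵥ e = 1) : (x ⬝ᵥ e)^2 ≤ x ⬝ᵥ x := by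
  have h := Finset.sum_mul_sq_le_sq_mul_sq univ x e
  simp only [dotProduct] at *
  have h1 : ∑ i, e i ^ 2 = 1 := by rw [← he]; exact Finset.sum_congr rfl fun i _ => by ring
  have h2 : ∑ i, x i ^ 2 = ∑ i, x i * x i := Finset.sum_congr rfl fun i _ => by ring
  rw [h1, h2] at h
  linarith

lemma dot_pos {n : ℕ} (x : Fin n → ℝ) (hx : x ≠ 0) : 0 < x ⬝ᵥ x := by
  have := dotProduct_self_star_pos_iff (v := x)
  simpa using this.2 hx

lemma lam1_ge {n : ℕ} (hn : 2 ≤ n) (G : SimpleGraph (Fin n)) (μ : ℝ) (x : Fin n → ℝ) (hx : x ≠ 0)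
    (h : μ * (x ⬝ᵥ x) ≤ x ⬝ᵥ (adjMat G *ᵥ x)) : μ ≤ lam 1 G := by
  obtain ⟨h21, e, he, hk⟩ := spectral_key hn G
  have h1 := hk x
  have h2 := dot_sq_le x e he
  have h3 := dot_pos x hx
  by_contra hc
  push Not at hc
  nlinarith [mul_le_mul_of_nonneg_left h2 (sub_nonneg.2 h21), mul_pos (sub_pos.2 hc) h3]

lemma lam_sum_ge {n : ℕ} (hn : 2 ≤ n) (G : SimpleGraph (Fin n)) (μ ρ : ℝ) (x y : Fin n → ℝ)
    (hx : x ≠ 0) (hy : y ≠ 0) (hxy : x ⬝ᵥ y = 0)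
    (h : μ * (x ⬝ᵥ x) ≤ x ⬝ᵥ (adjMat G *ᵥ x)) (h' : ρ * (y ⬝ᵥ y) ≤ y ⬝ᵥ (adjMat G *ᵥ y)) :
    μ + ρ ≤ lam 1 G + lam 2 G := by
  obtain ⟨h21, e, he, hk⟩ := spectral_key hn G
  have px := dot_pos x hx
  have py := dot_pos y hy
  set X := x ⬝ᵥ x with hX
  set Y := y ⬝ᵥ y with hY
  set s := x ⬝ᵥ e with hs
  set t := y ⬝ᵥ e with ht
  have hyx : y ⬝ᵥ x = 0 := by rw [dotProduct_comm]; exact hxy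
  have hex : e ⬝ᵥ x = s := dotProduct_comm _ _
  have hey : e ⬝ᵥ y = t := dotProduct_comm _ _
  -- Bessel
  have hB : s^2 / X + t^2 / Y ≤ 1 := by
    have h0 : 0 ≤ (e - (s/X) • x - (t/Y) • y) ⬝ᵥ (e - (s/X) • x - (t/Y) • y) := by
      have := dotProduct_self_star_nonneg (e - (s/X) • x - (t/Y) • y)
      simpa using this
    have h1 : (e - (s/X) • x - (t/Y) • y) ⬝ᵥ (e - (s/X) • x - (t/Y) • y) = 1 - s^2/X - t^2/Y := by
      simp only [sub_dotProduct, dotProduct_sub, smul_dotProduct, dotProduct_smul, hex, hey, he, hxy,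
        hyx, smul_eq_mul, ← hX, ← hY, ← hs, ← ht]
      field_simp
      ring
    linarith
  have a1 : μ ≤ lam 2 G + (lam 1 G - lam 2 G) * (s^2 / X) := by
    have := h.trans (hk x)
    rw [← mul_le_mul_iff_left₀ px]
    have e1 : (lam 2 G + (lam 1 G - lam 2 G) * (s^2 / X)) * X = lam 2 G * X + (lam 1 G - lam 2 G) * s^2 := by
      field_simp
    linarith
  have a2 : ρ ≤ lam 2 G + (lam 1 G - lam 2 G) * (t^2 / Y) := by
    have := h'.trans (hk y)
    rw [← mul_le_mul_iff_left₀ py]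
    have e1 : (lam 2 G + (lam 1 G - lam 2 G) * (t^2 / Y)) * Y = lam 2 G * Y + (lam 1 G - lam 2 G) * t^2 := by
      field_simp
    linarith
  nlinarith [mul_le_mul_of_nonneg_left hB (sub_nonneg.2 h21)]

lemma lam2_ge {n : ℕ} (hn : 2 ≤ n) (G : SimpleGraph (Fin n)) (ρ a b t : ℝ) (x y : Fin n → ℝ)
    (hx : x ≠ 0) (hy : y ≠ 0) (hxy : x ⬝ᵥ y = 0) (ha : 0 ≤ a) (hb : 0 ≤ b) (hab : t^2 ≤ a * b)
    (h : ρ * (x ⬝ᵥ x) + a ≤ x ⬝ᵥ (adjMat G *ᵥ x)) (h' : ρ * (y ⬝ᵥ y) + b ≤ y ⬝ᵥ (adjMat G *ᵥ y))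
    (hc : x ⬝ᵥ (adjMat G *ᵥ y) = t) :
    ρ ≤ lam 2 G := by
  obtain ⟨h21, e, he, hk⟩ := spectral_key hn G
  have px := dot_pos x hx
  have py := dot_pos y hy
  have hyx : y ⬝ᵥ x = 0 := by rw [dotProduct_comm]; exact hxy
  have hc' : y ⬝ᵥ (adjMat G *ᵥ x) = t := by
    have hsym : (adjMat G)ᵀ = adjMat G := by
      have := (adjMat_isHermitian G).eq
      simpa [Matrix.conjTranspose_eq_transpose_of_trivial] using this
    rw [Matrix.dotProduct_mulVec, ← Matrix.mulVec_transpose, hsym, dotProduct_comm, hc]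
  -- general combination
  have key : ∀ c d : ℝ, (c • x + d • y) ⬝ᵥ e = 0 → 0 < c^2 + d^2 → ρ ≤ lam 2 G := by
    intro c d h0 hcd
    have h1 := hk (c • x + d • y)
    rw [h0] at h1
    simp only [Matrix.mulVec_add, Matrix.mulVec_smul, add_dotProduct, dotProduct_add, smul_dotProduct,
      dotProduct_smul, hxy, hyx, smul_eq_mul, hc, hc'] at h1
    set X := x ⬝ᵥ x
    set Y := y ⬝ᵥ y
    have q : 0 ≤ a * c^2 + 2 * t * (c * d) + b * d^2 := by
      rcases eq_or_lt_of_le ha with h | h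
      · have : t = 0 := by
          have : t^2 ≤ 0 := by rw [← h] at hab; linarith
          nlinarith
        rw [this, ← h]; nlinarith [mul_nonneg hb (sq_nonneg d)]
      · have : 0 ≤ a * (a * c^2 + 2 * t * (c * d) + b * d^2) := by
          nlinarith [sq_nonneg (a * c + t * d), mul_le_mul_of_nonneg_right hab (sq_nonneg d)]
        exact nonneg_of_mul_nonneg_right this h
    have hpos : 0 < c^2 * X + d^2 * Y := by
      rcases eq_or_ne c 0 with h | h
      · have : 0 < d^2 := by rw [h] at hcd; nlinarith
        nlinarith [mul_pos this py, mul_nonneg (sq_nonneg c) px.le]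
      · have : 0 < c^2 := by positivity
        nlinarith [mul_pos this px, mul_nonneg (sq_nonneg d) py.le]
    by_contra hcon
    push Not at hcon
    nlinarith [mul_pos (sub_pos.2 hcon) hpos, mul_le_mul_of_nonneg_left h (sq_nonneg c),
      mul_le_mul_of_nonneg_left h' (sq_nonneg d)]
  by_cases hxe : x ⬝ᵥ e = 0
  · exact key 1 0 (by simp [hxe]) (by norm_num)
  · refine key (y ⬝ᵥ e) (-(x ⬝ᵥ e)) ?_ ?_
    · simp only [add_dotProduct, smul_dotProduct, smul_eq_mul]; ring
    · have : 0 < (x ⬝ᵥ e)^2 := by positivity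
      nlinarith [sq_nonneg (y ⬝ᵥ e)]

lemma path_mulVec (n : ℕ) (θ : ℝ) (hθ : Real.sin ((n + 1) * θ) = 0) :
    adjMat (SimpleGraph.pathGraph n) *ᵥ (fun j : Fin n => Real.sin (((j : ℕ) + 1) * θ)) =
      (2 * Real.cos θ) • (fun j : Fin n => Real.sin (((j : ℕ) + 1) * θ)) := by
  ext i
  simp only [mulVec, dotProduct, adjMat, SimpleGraph.pathGraph_adj, Pi.smul_apply, smul_eq_mul]
  have h1 : ∀ j : Fin n, (if (i : ℕ) + 1 = j ∨ (j : ℕ) + 1 = i then (1:ℝ) else 0) *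
      Real.sin (((j : ℕ) + 1) * θ) = (if (i : ℕ) + 1 = j then Real.sin (((j : ℕ) + 1) * θ) else 0)
        + (if (j : ℕ) + 1 = i then Real.sin (((j : ℕ) + 1) * θ) else 0) := by
    intro j
    by_cases a : (i : ℕ) + 1 = j
    · have b : ¬ ((j : ℕ) + 1 = i) := by omega
      simp [a, b]
    · by_cases b : (j : ℕ) + 1 = i <;> simp [a, b]
  simp_rw [h1]
  rw [Finset.sum_add_distrib]
  have s1 : ∑ j : Fin n, (if (i : ℕ) + 1 = j then Real.sin (((j : ℕ) + 1) * θ) else 0) =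
      Real.sin (((i : ℕ) + 2) * θ) := by
    by_cases h : (i : ℕ) + 1 < n
    · rw [Finset.sum_eq_single (⟨i + 1, h⟩ : Fin n)]
      · simp; ring_nf
      · intro b _ hb
        rw [if_neg]
        intro hh; apply hb; exact Fin.ext hh.symm
      · simp
    · rw [Finset.sum_eq_zero]
      · have : (n : ℝ) = (i : ℕ) + 1 := by
          have : n = (i : ℕ) + 1 := by have := i.2; omega
          exact_mod_cast this
        rw [← hθ, this]; ring_nf
      · intro j _
        rw [if_neg]; have := j.2; omega
  have s2 : ∑ j : Fin n, (if (j : ℕ) + 1 = i then Real.sin (((j : ℕ) + 1) * θ) else 0) =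
      Real.sin ((i : ℕ) * θ) := by
    by_cases h : (i : ℕ) = 0
    · rw [Finset.sum_eq_zero]
      · simp [h]
      · intro j _
        rw [if_neg]; omega
    · rw [Finset.sum_eq_single (⟨i - 1, by omega⟩ : Fin n)]
      · have : (((i : ℕ) - 1 : ℕ) : ℝ) + 1 = (i : ℕ) := by
          have : (i : ℕ) - 1 + 1 = (i : ℕ) := by omega
          exact_mod_cast this
        rw [if_pos (by simp; omega)]
        simp only [this]
      · intro b _ hb
        rw [if_neg]
        intro hh; apply hb; apply Fin.ext; simp; omega
      · simp
  rw [s1, s2]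
  have e1 : ((i : ℕ) + 2 : ℝ) * θ = ((i : ℕ) + 1) * θ + θ := by ring
  have e2 : ((i : ℕ) : ℝ) * θ = ((i : ℕ) + 1) * θ - θ := by ring
  rw [e1, e2, Real.sin_add, Real.sin_sub]
  ring

lemma path_root (n : ℕ) (k : ℕ) (hk : 1 ≤ k) (hkn : k ≤ n) :
    2 * Real.cos (k * Real.pi / (n + 1)) ∈ (adjMat (SimpleGraph.pathGraph n)).charpoly.roots := by
  set θ := k * Real.pi / (n + 1) with hθ
  have hn : (0:ℝ) < n + 1 := by positivity
  have h0 : Real.sin ((n + 1) * θ) = 0 := by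
    have : (n + 1) * θ = k * Real.pi := by rw [hθ]; field_simp
    rw [this]; exact Real.sin_nat_mul_pi k
  have h := path_mulVec n θ h0
  rw [Polynomial.mem_roots (Matrix.charpoly_monic _).ne_zero, Polynomial.IsRoot.def, Matrix.eval_charpoly,
    ← Matrix.exists_mulVec_eq_zero_iff]
  refine ⟨fun j : Fin n => Real.sin (((j : ℕ) + 1) * θ), ?_, ?_⟩
  · intro hz
    have := congrFun hz ⟨0, by omega⟩
    simp at this
    have hpos : 0 < Real.sin θ := by
      apply Real.sin_pos_of_pos_of_lt_pi
      · rw [hθ]; have : (0:ℝ) < k := by exact_mod_cast hk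
        positivity
      · rw [hθ, div_lt_iff₀ hn]
        have : (k:ℝ) < n + 1 := by exact_mod_cast Nat.lt_succ_of_le hkn
        nlinarith [Real.pi_pos]
    exact hpos.ne' this
  · rw [Matrix.sub_mulVec, h]
    ext i
    simp [Matrix.scalar_apply, Matrix.mulVec_diagonal]

lemma path_eigList (n : ℕ) :
    eigList (SimpleGraph.pathGraph n) =
      List.ofFn (fun i : Fin n => 2 * Real.cos (((n - i : ℕ) : ℝ) * Real.pi / (n + 1))) := by
  set l := List.ofFn (fun i : Fin n => 2 * Real.cos (((n - i : ℕ) : ℝ) * Real.pi / (n + 1))) with hl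
  have hmono : StrictMono (fun i : Fin n => 2 * Real.cos (((n - i : ℕ) : ℝ) * Real.pi / (n + 1))) := by
    intro i j hij
    have hn : (0:ℝ) < n + 1 := by positivity
    simp only
    have hlt : ((n - j : ℕ) : ℝ) < ((n - i : ℕ) : ℝ) := by
      have := i.2
      have := j.2
      have : (i : ℕ) < j := hij
      exact_mod_cast (by omega : n - (j : ℕ) < n - i)
    have hle : ((n - i : ℕ) : ℝ) ≤ n + 1 := by
      exact_mod_cast (by omega : n - (i : ℕ) ≤ n + 1)
    have := Real.cos_lt_cos_of_nonneg_of_le_pi (x := ((n - j : ℕ) : ℝ) * Real.pi / (n + 1))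
      (y := ((n - i : ℕ) : ℝ) * Real.pi / (n + 1)) (by positivity)
      (by rw [div_le_iff₀ hn]; nlinarith [Real.pi_pos])
      (by gcongr)
    linarith
  have hnodup : l.Nodup := List.nodup_ofFn.2 hmono.injective
  have hle : (l : Multiset ℝ) ≤ (adjMat (SimpleGraph.pathGraph n)).charpoly.roots := by
    rw [Multiset.le_iff_subset (by simpa using hnodup)]
    intro x hx
    simp only [hl, Multiset.mem_coe, List.mem_ofFn] at hx
    obtain ⟨i, rfl⟩ := hx
    exact path_root n _ (by omega) (by omega)
  have hcard : Multiset.card (adjMat (SimpleGraph.pathGraph n)).charpoly.roots ≤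
      Multiset.card (l : Multiset ℝ) := by
    refine (Polynomial.card_roots' _).trans ?_
    rw [Matrix.charpoly_natDegree_eq_dim]
    simp [hl]
  have heq := Multiset.eq_of_le_of_card_le hle hcard
  unfold eigList
  apply List.Perm.eq_of_pairwise' (r := (· ≤ ·))
  · exact Multiset.pairwise_sort _ _
  · rw [hl, List.pairwise_ofFn]
    intro i j hij
    exact (hmono hij).le
  · rw [← Multiset.coe_eq_coe, Multiset.sort_eq, heq]

lemma path_lam (n k : ℕ) (hk : 1 ≤ k) (hkn : k ≤ n) :
    lam k (SimpleGraph.pathGraph n) = 2 * Real.cos (k * Real.pi / (n + 1)) := by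
  unfold lam
  rw [path_eigList, List.getD_eq_getElem _ _ (by simp; omega)]
  simp only [List.getElem_ofFn]
  congr 4
  have : n - (n - k) = k := by omega
  rw [this]

/-- Chebyshev-like sequence. -/
noncomputable def chU (μ : ℝ) : ℕ → ℝ
  | 0 => 0
  | 1 => 1
  | (k+2) => μ * chU μ (k+1) - chU μ k

lemma chU_zero (μ : ℝ) : chU μ 0 = 0 := by simp [chU]
lemma chU_one (μ : ℝ) : chU μ 1 = 1 := by simp [chU]
lemma chU_succ (μ : ℝ) (k : ℕ) : chU μ (k+2) = μ * chU μ (k+1) - chU μ k := by simp [chU]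

lemma chU_step (μ : ℝ) (c j : ℕ) : ∀ i,
    chU μ (c+1+i) * chU μ (c+1+j) - chU μ (c+1) * chU μ (c+1+i+j) =
      chU μ (c+i) * chU μ (c+j) - chU μ c * chU μ (c+i+j)
  | 0 => by simp
  | 1 => by
    have h1 : chU μ (c+1+1) = μ * chU μ (c+1) - chU μ c := chU_succ μ c
    have h2 : chU μ (c+1+1+j) = μ * chU μ (c+1+j) - chU μ (c+j) := by
      have := chU_succ μ (c+j)
      rw [show c+1+1+j = c+j+2 by ring, show c+1+j = c+j+1 by ring]; exact this
    rw [h1, h2]; ring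
  | (i+2) => by
    have a := chU_step μ c j i
    have b := chU_step μ c j (i+1)
    have h1 : chU μ (c+1+(i+2)) = μ * chU μ (c+1+(i+1)) - chU μ (c+1+i) := chU_succ μ (c+1+i)
    have h2 : chU μ (c+(i+2)) = μ * chU μ (c+(i+1)) - chU μ (c+i) := chU_succ μ (c+i)
    have h3 : chU μ (c+1+(i+2)+j) = μ * chU μ (c+1+(i+1)+j) - chU μ (c+1+i+j) := by
      have := chU_succ μ (c+1+i+j)
      rw [show c+1+(i+2)+j = c+1+i+j+2 by ring, show c+1+(i+1)+j = c+1+i+j+1 by ring]; exact this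
    have h4 : chU μ (c+(i+2)+j) = μ * chU μ (c+(i+1)+j) - chU μ (c+i+j) := by
      have := chU_succ μ (c+i+j)
      rw [show c+(i+2)+j = c+i+j+2 by ring, show c+(i+1)+j = c+i+j+1 by ring]; exact this
    rw [h1, h2, h3, h4]
    linear_combination μ * b - a

lemma chU_ident (μ : ℝ) (i j : ℕ) : ∀ c,
    chU μ (c+i) * chU μ (c+j) - chU μ c * chU μ (c+i+j) = chU μ i * chU μ j
  | 0 => by simp [chU_zero]
  | (c+1) => by rw [chU_step, chU_ident]

/-- ratio -/
noncomputable def pr (μ : ℝ) (s : ℕ) : ℝ := chU μ s / chU μ (s+1)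

lemma pr_zero (μ : ℝ) : pr μ 0 = 0 := by simp [pr, chU_zero]

/-- positivity of the sequence up to a range -/
def Good (μ : ℝ) (S : ℕ) : Prop := (∀ k, 1 ≤ k → k ≤ S + 1 → 0 < chU μ k) ∧ 0 ≤ chU μ (S+2)

lemma Good.nonneg {μ : ℝ} {S : ℕ} (h : Good μ S) {k : ℕ} (hk : k ≤ S + 2) : 0 ≤ chU μ k := by
  rcases Nat.eq_zero_or_pos k with rfl | h0
  · rw [chU_zero]
  · rcases Nat.lt_or_ge k (S+2) with h1 | h1
    · exact (h.1 k h0 (by omega)).le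
    · rw [show k = S+2 by omega]; exact h.2

lemma Good.pr_nonneg {μ : ℝ} {S : ℕ} (h : Good μ S) {s : ℕ} (hs : s ≤ S) : 0 ≤ pr μ s :=
  div_nonneg (h.nonneg (by omega)) (h.nonneg (by omega))

lemma Good.pr_pos {μ : ℝ} {S : ℕ} (h : Good μ S) {s : ℕ} (hs : s ≤ S) (h0 : 1 ≤ s) : 0 < pr μ s :=
  div_pos (h.1 _ h0 (by omega)) (h.1 _ (by omega) (by omega))

lemma Good.rec {μ : ℝ} {S : ℕ} (h : Good μ S) {s : ℕ} (hs : s + 1 ≤ S) :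
    1 + pr μ (s+1) * pr μ s = μ * pr μ (s+1) := by
  have h1 := h.1 (s+1) (by omega) (by omega)
  have h2 := h.1 (s+2) (by omega) (by omega)
  unfold pr
  have := chU_succ μ s
  field_simp
  rw [show s + 1 + 1 = s + 2 by ring, this]; ring

lemma Good.diff {μ : ℝ} {S : ℕ} (h : Good μ S) (c i : ℕ) (hs : c + i ≤ S) :
    pr μ (c+i) - pr μ c = chU μ i / (chU μ (c+1) * chU μ (c+i+1)) := by
  have h1 := h.1 (c+1) (by omega) (by omega)
  have h2 := h.1 (c+i+1) (by omega) (by omega)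
  have := chU_ident μ i 1 c
  rw [chU_one] at this
  unfold pr
  rw [div_sub_div _ _ h2.ne' h1.ne']
  rw [div_eq_div_iff (by positivity) (by positivity)]
  linear_combination (chU μ (c+1) * chU μ (c+i+1)) * this

lemma Good.mono {μ : ℝ} {S : ℕ} (h : Good μ S) {a b : ℕ} (hab : a ≤ b) (hs : b ≤ S) :
    pr μ a ≤ pr μ b := by
  obtain ⟨i, rfl⟩ := Nat.exists_eq_add_of_le hab
  have := h.diff a i hs
  have h1 := h.1 (a+1) (by omega) (by omega)
  have h2 := h.1 (a+i+1) (by omega) (by omega)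
  have h3 := h.nonneg (k := i) (by omega)
  have : 0 ≤ pr μ (a+i) - pr μ a := by rw [this]; positivity
  linarith

lemma Good.exch {μ : ℝ} {S : ℕ} (h : Good μ S) (c i j : ℕ) (hs : c + i + (c + j) ≤ S) :
    pr μ c + pr μ (c+i+j) ≤ pr μ (c+i) + pr μ (c+j) := by
  have d1 := h.diff c i (by omega)
  have d2 := h.diff (c+j) i (by omega)
  have h1 := h.1 (c+1) (by omega) (by omega)
  have h2 := h.1 (c+i+1) (by omega) (by omega)
  have h3 := h.1 (c+j+1) (by omega) (by omega)
  have h4 := h.1 (c+j+i+1) (by omega) (by omega)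
  have h5 := h.nonneg (k := i) (by omega)
  have h6 := h.nonneg (k := j) (by omega)
  have h7 := h.nonneg (k := j + (c+1) + (c+1+i)) (by omega)
  have id := chU_ident μ (c+1) (c+1+i) j
  rw [show j + (c+1) = c+j+1 by ring, show j + (c+1+i) = c+j+i+1 by ring,
    show c + j + 1 + (c+1+i) = j + (c+1) + (c+1+i) by ring, show c+1+i = c+i+1 by ring] at id
  rw [show j + (c+1) + (c+1+i) = j + (c+1) + (c+i+1) by ring] at h7
  have hle : chU μ (c+1) * chU μ (c+i+1) ≤ chU μ (c+j+1) * chU μ (c+j+i+1) := by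
    have := mul_nonneg h6 h7
    linarith
  have : chU μ i / (chU μ (c+j+1) * chU μ (c+j+i+1)) ≤ chU μ i / (chU μ (c+1) * chU μ (c+i+1)) := by
    apply div_le_div_of_nonneg_left h5 (by positivity) hle
  rw [show c + i + j = c + j + i by ring]
  linarith

lemma Good.subadd {μ : ℝ} {S : ℕ} (h : Good μ S) (a b : ℕ) (hs : a + b ≤ S) :
    pr μ (a+b) ≤ pr μ a + pr μ b := by
  have := h.exch 0 a b (by omega)
  simpa [pr_zero] using this

lemma Good.subadd_sum {μ : ℝ} {S : ℕ} (h : Good μ S) {ι : Type*} (N : Finset ι) (f : ι → ℕ) :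
    ∑ i ∈ N, f i ≤ S → pr μ (∑ i ∈ N, f i) ≤ ∑ i ∈ N, pr μ (f i) := by
  induction N using Finset.induction_on with
  | empty => intro _; simp [pr_zero]
  | insert a N ha ih =>
    intro hs
    rw [Finset.sum_insert ha] at hs ⊢
    rw [Finset.sum_insert ha]
    have := h.subadd (f a) (∑ i ∈ N, f i) hs
    have := ih (by omega)
    linarith

lemma good_of_two_le {μ : ℝ} (hμ : 2 ≤ μ) (S : ℕ) : Good μ S := by
  have key : ∀ k, 0 ≤ chU μ k ∧ chU μ k + 1 ≤ chU μ (k+1) := by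
    intro k
    induction k with
    | zero => simp [chU_zero, chU_one]
    | succ k ih =>
      refine ⟨by linarith, ?_⟩
      rw [chU_succ]
      nlinarith
  refine ⟨?_, (key _).1⟩
  intro k hk _
  obtain ⟨j, rfl⟩ := Nat.exists_eq_add_of_le hk
  have := key j
  rw [add_comm 1 j]; linarith

lemma chU_trig (θ : ℝ) : ∀ k : ℕ, chU (2 * Real.cos θ) k * Real.sin θ = Real.sin (k * θ)
  | 0 => by simp [chU_zero]
  | 1 => by simp [chU_one]
  | (k+2) => by
    have a := chU_trig θ k
    have b := chU_trig θ (k+1)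
    rw [chU_succ, sub_mul, mul_assoc, a, b]
    push_cast
    rw [show ((k:ℝ)+2)*θ = (k+1)*θ + θ by ring, show (k:ℝ)*θ = (k+1)*θ - θ by ring, Real.sin_add,
      Real.sin_sub]
    ring

lemma good_trig {θ : ℝ} (h0 : 0 < θ) {S : ℕ} (h : (S+2) * θ ≤ Real.pi) : Good (2 * Real.cos θ) S := by
  have hpi : θ < Real.pi := by
    have : (0:ℝ) ≤ S := by positivity
    nlinarith
  have hs : 0 < Real.sin θ := Real.sin_pos_of_pos_of_lt_pi h0 hpi
  constructor
  · intro k hk hkS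
    have := chU_trig θ k
    have hk' : (1:ℝ) ≤ k := by exact_mod_cast hk
    have hkS' : (k:ℝ) ≤ S + 1 := by exact_mod_cast hkS
    have : 0 < Real.sin (k * θ) := by
      apply Real.sin_pos_of_pos_of_lt_pi
      · positivity
      · nlinarith
    rw [← chU_trig] at this
    exact pos_of_mul_pos_left this hs.le
  · have : 0 ≤ Real.sin (((S+2 : ℕ):ℝ) * θ) := by
      apply Real.sin_nonneg_of_nonneg_of_le_pi
      · positivity
      · push_cast; exact h
    rw [← chU_trig] at this
    exact nonneg_of_mul_nonneg_left this hs

/-- path spectral radius -/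
noncomputable def PP (k : ℕ) : ℝ := 2 * Real.cos (Real.pi / (k + 1))

lemma good_PP (s : ℕ) : Good (PP (s+1)) s := by
  apply good_trig
  · positivity
  · push_cast
    apply le_of_eq
    field_simp
    ring

lemma pr_PP (s : ℕ) : pr (PP (s+1)) s = PP (s+1) := by
  have h := (good_PP s).1 (s+1) (by omega) (by omega)
  have h2 : chU (PP (s+1)) (s+2) = 0 := by
    have hp : (0:ℝ) < s + 1 + 1 := by positivity
    have := chU_trig (Real.pi / ((s+1 : ℕ) + 1)) (s+2)
    have e : ((s+2:ℕ):ℝ) * (Real.pi / ((s+1 : ℕ) + 1)) = Real.pi := by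
      push_cast; field_simp; ring
    rw [e, Real.sin_pi] at this
    have hs : 0 < Real.sin (Real.pi / ((s+1 : ℕ) + 1)) := by
      apply Real.sin_pos_of_pos_of_lt_pi (by positivity)
      push_cast
      rw [div_lt_iff₀ hp]
      nlinarith [Real.pi_pos, mul_nonneg (Nat.cast_nonneg (α := ℝ) s) Real.pi_pos.le]
    exact (mul_eq_zero.1 this).resolve_right hs.ne'
  rw [chU_succ] at h2
  unfold pr
  rw [div_eq_iff h.ne']
  linarith

/-- the minimal total for legs of size at most `m` and total size `α` -/
noncomputable def GG (μ : ℝ) (m α : ℕ) : ℝ := (α / m : ℕ) * pr μ m + pr μ (α % m)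

lemma GG_add {μ : ℝ} (hμ : 2 ≤ μ) {m : ℕ} (hm : 1 ≤ m) (α s : ℕ) (hs : s ≤ m) :
    GG μ m (α + s) ≤ pr μ s + GG μ m α := by
  unfold GG
  have hr := Nat.mod_lt α hm
  have hdm := Nat.div_add_mod α m
  set q := α / m
  set r := α % m
  have hα : α = m * q + r := hdm.symm
  rcases Nat.lt_trichotomy (r + s) m with h | h | h
  · have e1 : (α + s) / m = q := by
      rw [hα, add_assoc, Nat.mul_add_div hm, Nat.div_eq_of_lt h, add_zero]
    have e2 : (α + s) % m = r + s := by
      rw [hα, add_assoc, Nat.mul_add_mod, Nat.mod_eq_of_lt h]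
    rw [e1, e2]
    have := (good_of_two_le hμ (r+s)).subadd r s le_rfl
    linarith
  · have e1 : (α + s) / m = q + 1 := by
      rw [hα, add_assoc, Nat.mul_add_div hm, h, Nat.div_self hm]
    have e2 : (α + s) % m = 0 := by
      rw [hα, add_assoc, Nat.mul_add_mod, h, Nat.mod_self]
    rw [e1, e2]
    have := (good_of_two_le hμ (r+s)).subadd r s le_rfl
    rw [h] at this
    rw [pr_zero]; push_cast
    linarith
  · obtain ⟨c, hc⟩ : ∃ c, r + s = m + c := Nat.exists_eq_add_of_le h.le
    have hcm : c < m := by omega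
    have e1 : (α + s) / m = q + 1 := by
      rw [hα, add_assoc, Nat.mul_add_div hm, hc, Nat.add_div_left _ hm, Nat.div_eq_of_lt hcm]
    have e2 : (α + s) % m = c := by
      rw [hα, add_assoc, Nat.mul_add_mod, hc, Nat.add_mod_left, Nat.mod_eq_of_lt hcm]
    rw [e1, e2]
    obtain ⟨i, hi⟩ : ∃ i, r = c + i := Nat.exists_eq_add_of_le (by omega)
    obtain ⟨j, hj⟩ : ∃ j, s = c + j := Nat.exists_eq_add_of_le (by omega)
    have := (good_of_two_le hμ (r+s)).exch c i j (by omega)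
    have e3 : c + i + j = m := by omega
    rw [e3, ← hi, ← hj] at this
    push_cast
    linarith

lemma GG_mono {μ : ℝ} (hμ : 2 ≤ μ) {m : ℕ} (hm : 1 ≤ m) {α β : ℕ} (h : α ≤ β) :
    GG μ m α ≤ GG μ m β := by
  induction β, h using Nat.le_induction with
  | base => exact le_rfl
  | succ β _ ih =>
    refine ih.trans ?_
    unfold GG
    have hr := Nat.mod_lt β hm
    have hdm := Nat.div_add_mod β m
    set q := β / m
    set r := β % m
    have hα : β = m * q + r := hdm.symm
    rcases Nat.lt_or_ge (r + 1) m with h | h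
    · have e1 : (β + 1) / m = q := by
        rw [hα, add_assoc, Nat.mul_add_div hm, Nat.div_eq_of_lt h, add_zero]
      have e2 : (β + 1) % m = r + 1 := by
        rw [hα, add_assoc, Nat.mul_add_mod, Nat.mod_eq_of_lt h]
      rw [e1, e2]
      have := (good_of_two_le hμ (r+1)).mono (a := r) (b := r+1) (by omega) le_rfl
      linarith
    · have h' : r + 1 = m := by omega
      have e1 : (β + 1) / m = q + 1 := by
        rw [hα, add_assoc, Nat.mul_add_div hm, h', Nat.div_self hm]
      have e2 : (β + 1) % m = 0 := by
        rw [hα, add_assoc, Nat.mul_add_mod, h', Nat.mod_self]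
      rw [e1, e2, pr_zero]
      have := (good_of_two_le hμ m).mono (a := r) (b := m) (by omega) le_rfl
      push_cast
      linarith

lemma GG_sum {μ : ℝ} (hμ : 2 ≤ μ) {m : ℕ} (hm : 1 ≤ m) {ι : Type*} (N : Finset ι) (f : ι → ℕ)
    (hf : ∀ i ∈ N, f i ≤ m) : GG μ m (∑ i ∈ N, f i) ≤ ∑ i ∈ N, pr μ (f i) := by
  induction N using Finset.induction_on with
  | empty => simp [GG, pr_zero]
  | insert a N ha ih =>
    rw [Finset.sum_insert ha, Finset.sum_insert ha, add_comm (f a)]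
    have := GG_add hμ hm (∑ i ∈ N, f i) (f a) (hf a (by simp))
    have := ih (fun i hi => hf i (by simp [hi]))
    linarith

/-- The branch of `w` seen from `u`. -/
noncomputable def br {n : ℕ} (T : SimpleGraph (Fin n)) (u w : Fin n) : Finset (Fin n) :=
  univ.filter (fun z => T.dist z w < T.dist z u)

/-- Neighbours. -/
noncomputable def nb {n : ℕ} (T : SimpleGraph (Fin n)) (v : Fin n) : Finset (Fin n) :=
  univ.filter (fun w => T.Adj v w)

lemma mem_br {n : ℕ} {T : SimpleGraph (Fin n)} {u w z : Fin n} :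
    z ∈ br T u w ↔ T.dist z w < T.dist z u := by simp [br]

lemma mem_nb {n : ℕ} {T : SimpleGraph (Fin n)} {v w : Fin n} : w ∈ nb T v ↔ T.Adj v w := by
  simp [nb]

lemma dist_adj {n : ℕ} {T : SimpleGraph (Fin n)} (hT : T.IsTree) {u w : Fin n} (h : T.Adj u w)
    (z : Fin n) : T.dist z u = T.dist z w + 1 ∨ T.dist z w = T.dist z u + 1 :=
  hT.dist_eq_dist_add_one_of_adj z h

lemma closer_unique {n : ℕ} {T : SimpleGraph (Fin n)} (hT : T.IsTree) {w w1 w2 z : Fin n}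
    (h1 : T.Adj w w1) (h2 : T.Adj w w2) (d1 : T.dist z w1 < T.dist z w)
    (d2 : T.dist z w2 < T.dist z w) : w1 = w2 := by
  obtain ⟨p1, hp1⟩ := hT.connected.exists_walk_length_eq_dist z w1
  obtain ⟨p2, hp2⟩ := hT.connected.exists_walk_length_eq_dist z w2
  have e1 : (p1.concat h1.symm).length = T.dist z w := by
    rw [SimpleGraph.Walk.length_concat, hp1]
    rcases dist_adj hT h1 z with h | h <;> omega
  have e2 : (p2.concat h2.symm).length = T.dist z w := by
    rw [SimpleGraph.Walk.length_concat, hp2]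
    rcases dist_adj hT h2 z with h | h <;> omega
  have q1 := SimpleGraph.Walk.isPath_of_length_eq_dist _ e1
  have q2 := SimpleGraph.Walk.isPath_of_length_eq_dist _ e2
  have := hT.isAcyclic.path_unique ⟨_, q1⟩ ⟨_, q2⟩
  have h := congrArg (fun p => (Subtype.val p).penultimate) this
  simpa using h

lemma closer_exists {n : ℕ} {T : SimpleGraph (Fin n)} (hT : T.IsTree) {w z : Fin n}
    (h : z ≠ w) : ∃ w', T.Adj w w' ∧ T.dist z w' < T.dist z w := by
  obtain ⟨p, hp⟩ := hT.connected.exists_walk_length_eq_dist w z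
  cases p with
  | nil => exact absurd rfl h
  | cons hadj q =>
    refine ⟨_, hadj, ?_⟩
    have := SimpleGraph.dist_le q
    rw [SimpleGraph.Walk.length_cons] at hp
    rw [SimpleGraph.dist_comm, SimpleGraph.dist_comm (u := z)]
    omega

lemma mem_br_or {n : ℕ} {T : SimpleGraph (Fin n)} (hT : T.IsTree) {u w : Fin n} (h : T.Adj u w)
    (z : Fin n) : z ∉ br T u w ↔ z ∈ br T w u := by
  rw [mem_br, mem_br]
  rcases dist_adj hT h z with h | h <;> omega

lemma br_compl {n : ℕ} {T : SimpleGraph (Fin n)} (hT : T.IsTree) {u w : Fin n} (h : T.Adj u w) :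
    br T w u = (br T u w)ᶜ := by
  ext z; rw [mem_compl, mem_br_or hT h]

lemma br_card_add {n : ℕ} {T : SimpleGraph (Fin n)} (hT : T.IsTree) {u w : Fin n}
    (h : T.Adj u w) : (br T u w).card + (br T w u).card = n := by
  rw [br_compl hT h, card_add_card_compl, Fintype.card_fin]

lemma self_mem_br {n : ℕ} {T : SimpleGraph (Fin n)} {u w : Fin n} (h : T.Adj u w) :
    w ∈ br T u w := by
  rw [mem_br, SimpleGraph.dist_self, SimpleGraph.dist_eq_one_iff_adj.2 h.symm]; norm_num

lemma base_notMem_br {n : ℕ} {T : SimpleGraph (Fin n)} {u w : Fin n} :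
    u ∉ br T u w := by
  rw [mem_br, SimpleGraph.dist_self]; omega

lemma br_card_pos {n : ℕ} {T : SimpleGraph (Fin n)} {u w : Fin n} (h : T.Adj u w) :
    1 ≤ (br T u w).card := card_pos.2 ⟨w, self_mem_br h⟩

lemma br_disj {n : ℕ} {T : SimpleGraph (Fin n)} (hT : T.IsTree) {v w1 w2 : Fin n}
    (h1 : T.Adj v w1) (h2 : T.Adj v w2) (hne : w1 ≠ w2) : Disjoint (br T v w1) (br T v w2) := by
  rw [disjoint_left]
  intro z hz1 hz2
  exact hne (closer_unique hT h1 h2 (mem_br.1 hz1) (mem_br.1 hz2))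

lemma br_cover {n : ℕ} {T : SimpleGraph (Fin n)} (hT : T.IsTree) (v : Fin n) :
    insert v ((nb T v).biUnion (br T v)) = univ := by
  ext z
  simp only [mem_insert, mem_biUnion, mem_univ, iff_true]
  by_cases h : z = v
  · exact Or.inl h
  · obtain ⟨w, hw, hd⟩ := closer_exists hT h
    exact Or.inr ⟨w, mem_nb.2 hw, mem_br.2 hd⟩

lemma br_decomp {n : ℕ} {T : SimpleGraph (Fin n)} (hT : T.IsTree) {u w : Fin n} (h : T.Adj u w) :
    insert w (((nb T w).erase u).biUnion (br T w)) = br T u w := by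
  ext z
  simp only [mem_insert, mem_biUnion, mem_erase]
  constructor
  · rintro (rfl | ⟨w', ⟨hne, hw'⟩, hz⟩)
    · exact self_mem_br h
    · by_contra hc
      rw [mem_br_or hT h] at hc
      exact hne (closer_unique hT (mem_nb.1 hw') h.symm (mem_br.1 hz) (mem_br.1 hc))
  · intro hz
    by_cases hzw : z = w
    · exact Or.inl hzw
    · obtain ⟨w', hw', hd⟩ := closer_exists hT hzw
      refine Or.inr ⟨w', ⟨?_, mem_nb.2 hw'⟩, mem_br.2 hd⟩
      rintro rfl
      have := mem_br.1 hz
      omega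

lemma card_insert_biUnion {n : ℕ} {T : SimpleGraph (Fin n)} (hT : T.IsTree) (v : Fin n)
    (N : Finset (Fin n)) (hN : N ⊆ nb T v) :
    (insert v (N.biUnion (br T v))).card = (∑ w ∈ N, (br T v w).card) + 1 := by
  rw [card_insert_of_notMem, card_biUnion]
  · intro a ha b hb hab
    exact br_disj hT (mem_nb.1 (hN ha)) (mem_nb.1 (hN hb)) hab
  · simp only [mem_biUnion, not_exists, not_and]
    intro w _; exact base_notMem_br

lemma sum_br {n : ℕ} {T : SimpleGraph (Fin n)} (hT : T.IsTree) (v : Fin n) :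
    (∑ w ∈ nb T v, (br T v w).card) + 1 = n := by
  rw [← card_insert_biUnion hT v _ (Subset.refl _), br_cover hT, card_univ, Fintype.card_fin]

lemma sum_br' {n : ℕ} {T : SimpleGraph (Fin n)} (hT : T.IsTree) {u w : Fin n} (h : T.Adj u w) :
    (∑ w' ∈ (nb T w).erase u, (br T w w').card) + 1 = (br T u w).card := by
  rw [← card_insert_biUnion hT w _ (erase_subset _ _), br_decomp hT h]

lemma br_exit {n : ℕ} {T : SimpleGraph (Fin n)} (hT : T.IsTree) {w w' z z' : Fin n}
    (h : T.Adj w w') (hz : z ∈ br T w w') (hz' : z' ∉ br T w w') (hzz : T.Adj z z') :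
    z = w' ∧ z' = w := by
  rw [mem_br_or hT h] at hz'
  rw [mem_br] at hz hz'
  have a1 := dist_adj hT h z
  have a2 := dist_adj hT h z'
  have b1 := dist_adj hT hzz w
  have b2 := dist_adj hT hzz w'
  simp only [SimpleGraph.dist_comm (u := w), SimpleGraph.dist_comm (u := w')] at b1 b2
  have hzw : z = w' := by
    by_contra hne
    obtain ⟨y, hy, hd⟩ := closer_exists hT (z := w') (w := z) (Ne.symm hne)
    have c1 := dist_adj hT h y
    have hd2 : T.dist y w' < T.dist z w' := by
      rwa [SimpleGraph.dist_comm, SimpleGraph.dist_comm (u := z)]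
    have : y = z' := by
      apply closer_unique hT hy hzz (z := w)
      · rw [SimpleGraph.dist_comm, SimpleGraph.dist_comm (u := w)]; omega
      · rw [SimpleGraph.dist_comm, SimpleGraph.dist_comm (u := w)]; omega
    subst this
    omega
  refine ⟨hzw, ?_⟩
  subst hzw
  rw [SimpleGraph.dist_self] at *
  exact (hT.connected.dist_eq_zero_iff).1 (by omega)

/-- `x` is a rooted test vector at `v` with support in `B`. -/
structure RV {n : ℕ} (T : SimpleGraph (Fin n)) (μ : ℝ) (v : Fin n) (B : Finset (Fin n)) (q : ℝ)
    (x : Fin n → ℝ) : Prop where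
  root : x v = 1
  nonneg : ∀ z, 0 ≤ x z
  supp : ∀ z, z ∉ B → x z = 0
  rootA : q ≤ (adjMat T *ᵥ x) v
  ineq : ∀ z, z ∈ B → z ≠ v → μ * x z ≤ (adjMat T *ᵥ x) z

lemma adj_mulVec {n : ℕ} (T : SimpleGraph (Fin n)) (x : Fin n → ℝ) (z : Fin n) :
    (adjMat T *ᵥ x) z = ∑ z' ∈ nb T z, x z' := by
  simp only [Matrix.mulVec, dotProduct, adjMat, nb, ite_mul, one_mul, zero_mul, sum_filter]

lemma adj_mono {n : ℕ} (T : SimpleGraph (Fin n)) {x y : Fin n → ℝ} (h : ∀ z, x z ≤ y z)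
    (z : Fin n) : (adjMat T *ᵥ x) z ≤ (adjMat T *ᵥ y) z := by
  rw [adj_mulVec, adj_mulVec]; exact sum_le_sum fun i _ => h i

lemma RV.quad {n : ℕ} {T : SimpleGraph (Fin n)} {μ : ℝ} {v : Fin n} {B : Finset (Fin n)} {q : ℝ}
    {x : Fin n → ℝ} (h : RV T μ v B q x) :
    μ * (x ⬝ᵥ x) + (q - μ) ≤ x ⬝ᵥ (adjMat T *ᵥ x) := by
  have e : μ * (x ⬝ᵥ x) + (q - μ) = ∑ z, (μ * (x z * x z) + if z = v then q - μ else 0) := by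
    rw [sum_add_distrib, ← mul_sum]; simp [dotProduct]
  rw [e]
  unfold dotProduct
  refine sum_le_sum fun z _ => ?_
  by_cases hz : z = v
  · subst hz
    rw [if_pos rfl, h.root]
    linarith [h.rootA]
  · rw [if_neg hz, add_zero]
    by_cases hB : z ∈ B
    · nlinarith [h.ineq z hB hz, h.nonneg z]
    · rw [h.supp z hB]; simp

lemma RV.ne_zero {n : ℕ} {T : SimpleGraph (Fin n)} {μ : ℝ} {v : Fin n} {B : Finset (Fin n)} {q : ℝ}
    {x : Fin n → ℝ} (h : RV T μ v B q x) : x ≠ 0 := by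
  rintro rfl
  have := h.root
  simp at this

/-- Branch vectors. -/
structure BV {n : ℕ} (T : SimpleGraph (Fin n)) (μ : ℝ) (u w : Fin n) (q : ℝ)
    (x : Fin n → ℝ) : Prop where
  root : x w = q
  nonneg : ∀ z, 0 ≤ x z
  supp : ∀ z, z ∉ br T u w → x z = 0
  ineq : ∀ z, z ∈ br T u w → μ * x z ≤ (if z = w then 1 else 0) + (adjMat T *ᵥ x) z

lemma RV.build {n : ℕ} {T : SimpleGraph (Fin n)} (hT : T.IsTree) {μ : ℝ} (v : Fin n)
    (N : Finset (Fin n)) (hN : N ⊆ nb T v) (q : Fin n → ℝ) (y : Fin n → Fin n → ℝ)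
    (hy : ∀ w ∈ N, BV T μ v w (q w) (y w)) :
    ∃ x, RV T μ v (insert v (N.biUnion (br T v))) (∑ w ∈ N, q w) x := by
  let x : Fin n → ℝ := fun z => (if z = v then 1 else 0) + ∑ w ∈ N, y w z
  have hy0 : ∀ w ∈ N, ∀ z, 0 ≤ y w z := fun w hw z => (hy w hw).nonneg z
  have hsum : ∀ w ∈ N, ∀ z ∈ br T v w, ∑ w' ∈ N, y w' z = y w z := by
    intro w hw z hz
    refine sum_eq_single_of_mem w hw fun w' hw' hne => ?_
    apply (hy w' hw').supp
    exact disjoint_left.1 (br_disj hT (mem_nb.1 (hN hw)) (mem_nb.1 (hN hw')) hne.symm) hz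
  refine ⟨x, ?_, ?_, ?_, ?_, ?_⟩
  · have : ∑ w ∈ N, y w v = 0 := sum_eq_zero fun w hw => (hy w hw).supp v base_notMem_br
    simp [x, this]
  · intro z
    have : 0 ≤ ∑ w ∈ N, y w z := sum_nonneg fun w hw => hy0 w hw z
    simp only [x]; split_ifs <;> linarith
  · intro z hz
    simp only [mem_insert, mem_biUnion, not_or, not_exists, not_and] at hz
    have : ∑ w ∈ N, y w z = 0 := sum_eq_zero fun w hw => (hy w hw).supp z (hz.2 w hw)
    simp [x, this, hz.1]
  · rw [adj_mulVec]
    have h1 : ∑ w ∈ N, q w ≤ ∑ w ∈ N, x w := by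
      refine sum_le_sum fun w hw => ?_
      have hwv : w ≠ v := (T.ne_of_adj (mem_nb.1 (hN hw))).symm
      simp only [x, if_neg hwv, zero_add]
      rw [hsum w hw w (self_mem_br (mem_nb.1 (hN hw))), (hy w hw).root]
    refine h1.trans (sum_le_sum_of_subset_of_nonneg hN fun z _ _ => ?_)
    have : 0 ≤ ∑ w ∈ N, y w z := sum_nonneg fun w hw => hy0 w hw z
    simp only [x]; split_ifs <;> linarith
  · intro z hz hzv
    simp only [mem_insert, mem_biUnion, hzv, false_or] at hz
    obtain ⟨w, hw, hz⟩ := hz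
    have e : x z = y w z := by simp only [x, if_neg hzv, zero_add]; exact hsum w hw z hz
    rw [e]
    refine ((hy w hw).ineq z hz).trans ?_
    have h2 : (if z = w then (1:ℝ) else 0) + (adjMat T *ᵥ y w) z
        ≤ (adjMat T *ᵥ (fun z' => if z' = v then 1 else 0)) z + (adjMat T *ᵥ y w) z := by
      gcongr
      rw [adj_mulVec]
      simp only [sum_ite_eq']
      split_ifs with h1 h2 h2
      · exact le_rfl
      · subst h1; exact absurd (mem_nb.2 (mem_nb.1 (hN hw)).symm) h2
      · norm_num
      · exact le_rfl
    refine h2.trans ?_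
    rw [← Pi.add_apply, ← Matrix.mulVec_add]
    refine adj_mono T (fun z' => ?_) z
    simp only [x, Pi.add_apply]
    gcongr
    exact single_le_sum (f := fun w => y w z') (fun w hw => hy0 w hw z') hw

/-- positivity of the first values -/
def Pos (μ : ℝ) (S : ℕ) : Prop := ∀ k, 1 ≤ k → k ≤ S + 1 → 0 < chU μ k

lemma Pos.good {μ : ℝ} {S s : ℕ} (h : Pos μ S) (hs : s + 1 ≤ S) : Good μ s :=
  ⟨fun k h1 h2 => h k h1 (by omega), (h (s+2) (by omega) (by omega)).le⟩

lemma Pos.rec {μ : ℝ} {S : ℕ} (h : Pos μ S) {s : ℕ} (hs : s + 1 ≤ S) :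
    1 + pr μ (s+1) * pr μ s = μ * pr μ (s+1) := by
  have h1 := h (s+1) (by omega) (by omega)
  have h2 := h (s+2) (by omega) (by omega)
  unfold pr
  rw [show s + 1 + 1 = s + 2 by rfl]
  field_simp
  rw [chU_succ]; ring

lemma Pos.pr_nonneg {μ : ℝ} {S : ℕ} (h : Pos μ S) {s : ℕ} (hs : s ≤ S) : 0 ≤ pr μ s := by
  unfold pr
  rcases Nat.eq_zero_or_pos s with rfl | h0
  · simp [chU_zero]
  · exact div_nonneg (h s h0 (by omega)).le (h (s+1) (by omega) (by omega)).le

lemma BV.exists {n : ℕ} {T : SimpleGraph (Fin n)} (hT : T.IsTree) {μ : ℝ} {S : ℕ} (hg : Pos μ S) :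
    ∀ (s : ℕ), s ≤ S → ∀ u w, T.Adj u w → (br T u w).card = s → ∃ x, BV T μ u w (pr μ s) x := by
  intro s
  induction s using Nat.strong_induction_on with
  | _ s ih =>
    intro hs u w huw hc
    have hsum := sum_br' hT huw
    set N := (nb T w).erase u with hNdef
    have hN : N ⊆ nb T w := erase_subset _ _
    have hex : ∀ w' : Fin n, ∃ x, w' ∈ N → BV T μ w w' (pr μ (br T w w').card) x := by
      intro w'
      by_cases hw' : w' ∈ N
      · have hle : (br T w w').card ≤ ∑ w' ∈ N, (br T w w').card :=
          single_le_sum (f := fun w' => (br T w w').card) (fun _ _ => Nat.zero_le _) hw'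
        obtain ⟨x, hx⟩ := ih (br T w w').card (by omega) (by omega) w w' (mem_nb.1 (hN hw')) rfl
        exact ⟨x, fun _ => hx⟩
      · exact ⟨0, fun h => absurd h hw'⟩
    choose y hy using hex
    obtain ⟨x, hx⟩ := RV.build hT w N hN (fun w' => pr μ (br T w w').card) y hy
    rw [br_decomp hT huw] at hx
    obtain ⟨s', rfl⟩ : ∃ s', s = s' + 1 := ⟨s - 1, by omega⟩
    have hp := hg.pr_nonneg hs
    have hrec := hg.rec hs
    have hsub := (hg.good hs).subadd_sum N (fun w' => (br T w w').card) (by omega)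
    have hs' : ∑ w' ∈ N, (br T w w').card = s' := by omega
    rw [hs'] at hsub
    refine ⟨pr μ (s'+1) • x, ?_, ?_, ?_, ?_⟩
    · simp [hx.root]
    · intro z; exact mul_nonneg hp (hx.nonneg z)
    · intro z hz; simp [hx.supp z hz]
    · intro z hz
      rw [Matrix.mulVec_smul]
      simp only [Pi.smul_apply, smul_eq_mul]
      by_cases hzw : z = w
      · subst hzw
        rw [if_pos rfl, hx.root]
        have := mul_le_mul_of_nonneg_left (hsub.trans hx.rootA) hp
        linarith
      · rw [if_neg hzw]
        have := mul_le_mul_of_nonneg_left (hx.ineq z hz hzw) hp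
        linarith

lemma RV.exists {n : ℕ} {T : SimpleGraph (Fin n)} (hT : T.IsTree) {μ : ℝ} {S : ℕ} (hg : Pos μ S)
    (v : Fin n) (N : Finset (Fin n)) (hN : N ⊆ nb T v) (hS : ∀ w ∈ N, (br T v w).card ≤ S) :
    ∃ x, RV T μ v (insert v (N.biUnion (br T v))) (∑ w ∈ N, pr μ (br T v w).card) x := by
  have hex : ∀ w' : Fin n, ∃ x, w' ∈ N → BV T μ v w' (pr μ (br T v w').card) x := by
    intro w'
    by_cases hw' : w' ∈ N
    · obtain ⟨x, hx⟩ := BV.exists hT hg _ (hS w' hw') v w' (mem_nb.1 (hN hw')) rfl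
      exact ⟨x, fun _ => hx⟩
    · exact ⟨0, fun h => absurd h hw'⟩
  choose y hy using hex
  exact RV.build hT v N hN _ y hy

/-- sum over the branches at `u` other than `v` -/
noncomputable def YY {n : ℕ} (T : SimpleGraph (Fin n)) (μ : ℝ) (u v : Fin n) : ℝ :=
  ∑ w ∈ (nb T u).erase v, pr μ (br T u w).card

lemma RV.side {n : ℕ} {T : SimpleGraph (Fin n)} (hT : T.IsTree) {μ : ℝ} {S : ℕ} (hg : Pos μ S)
    {u v : Fin n} (h : T.Adj u v) (hS : ∀ w ∈ (nb T u).erase v, (br T u w).card ≤ S) :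
    ∃ x, RV T μ u (br T v u) (YY T μ u v) x := by
  have := RV.exists hT hg u ((nb T u).erase v) (erase_subset _ _) hS
  rwa [br_decomp hT h.symm] at this

/-- a side of size `s` has a test vector with Rayleigh quotient `PP s`. -/
lemma RV.sidePP {n : ℕ} {T : SimpleGraph (Fin n)} (hT : T.IsTree)
    {u v : Fin n} (h : T.Adj u v) :
    ∃ x, RV T (PP (br T v u).card) u (br T v u) (PP (br T v u).card) x := by
  have hsum := sum_br' hT h.symm
  obtain ⟨s, hs⟩ : ∃ s, (br T v u).card = s + 1 := ⟨_, hsum.symm⟩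
  rw [hs] at hsum ⊢
  have hs' : ∑ w' ∈ (nb T u).erase v, (br T u w').card = s := by omega
  have hg := good_PP s
  have hS : ∀ w ∈ (nb T u).erase v, (br T u w).card ≤ s := by
    intro w hw
    rw [← hs']
    exact single_le_sum (f := fun w' => (br T u w').card) (fun _ _ => Nat.zero_le _) hw
  obtain ⟨x, hx⟩ := RV.side hT hg.1 h hS
  have hsub := hg.subadd_sum ((nb T u).erase v) (fun w' => (br T u w').card) (by omega)
  rw [hs', pr_PP] at hsub
  exact ⟨x, hx.root, hx.nonneg, hx.supp, hsub.trans hx.rootA, hx.ineq⟩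

lemma dot_disj {n : ℕ} {x y : Fin n → ℝ} {B C : Finset (Fin n)} (hx : ∀ z, z ∉ B → x z = 0)
    (hy : ∀ z, z ∉ C → y z = 0) (hd : Disjoint B C) : x ⬝ᵥ y = 0 := by
  unfold dotProduct
  refine sum_eq_zero fun z _ => ?_
  by_cases hz : z ∈ B
  · rw [hy z (disjoint_left.1 hd hz), mul_zero]
  · rw [hx z hz, zero_mul]

lemma side_disj {n : ℕ} {T : SimpleGraph (Fin n)} (hT : T.IsTree)
    {u v : Fin n} (h : T.Adj u v) : Disjoint (br T v u) (br T u v) := by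
  rw [br_compl hT h.symm]; exact disjoint_compl_right

lemma cross_one {n : ℕ} {T : SimpleGraph (Fin n)} (hT : T.IsTree)
    {u v : Fin n} (h : T.Adj u v) {x y : Fin n → ℝ} (hx : ∀ z, z ∉ br T v u → x z = 0)
    (hy : ∀ z, z ∉ br T u v → y z = 0) : x ⬝ᵥ (adjMat T *ᵥ y) = x u * y v := by
  unfold dotProduct
  rw [Finset.sum_eq_single u]
  · rw [adj_mulVec, Finset.sum_eq_single v]
    · intro z hz hne
      apply hy
      intro hz2
      exact hne (br_exit hT h hz2 base_notMem_br (mem_nb.1 hz).symm).1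
    · intro hc; exact absurd (mem_nb.2 h) hc
  · intro z _ hne
    by_cases hz : z ∈ br T v u
    · rw [adj_mulVec, sum_eq_zero, mul_zero]
      intro z' hz'
      apply hy
      intro hz2
      rw [← mem_br_or hT h.symm] at hz2
      exact hne (br_exit hT h.symm hz hz2 (mem_nb.1 hz')).1
    · rw [hx z hz, zero_mul]
  · simp

lemma cross_zero {n : ℕ} {T : SimpleGraph (Fin n)} (hT : T.IsTree)
    {v w1 w2 : Fin n} (h1 : T.Adj v w1) (h2 : T.Adj v w2) (hne : w1 ≠ w2)
    {x y : Fin n → ℝ} (hx : ∀ z, z ∉ br T v w1 → x z = 0)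
    (hy : ∀ z, z ∉ br T v w2 → y z = 0) : x ⬝ᵥ (adjMat T *ᵥ y) = 0 := by
  refine dot_disj (B := br T v w1) (C := (br T v w1)ᶜ) hx ?_ disjoint_compl_right
  intro z hz
  simp only [mem_compl, not_not] at hz
  rw [adj_mulVec, sum_eq_zero]
  intro z' hz'
  apply hy
  intro hz2
  have h3 : z' ∉ br T v w1 := disjoint_right.1 (br_disj hT h1 h2 hne) hz2
  have := (br_exit hT h1 hz h3 (mem_nb.1 hz')).2
  subst this
  exact base_notMem_br hz2

lemma PP_mono {a b : ℕ} (h : a ≤ b) : PP a ≤ PP b := by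
  unfold PP
  have : Real.pi / (b + 1) ≤ Real.pi / (a + 1) := by
    gcongr
  have h2 : Real.pi / ((a:ℝ) + 1) ≤ Real.pi := by
    apply div_le_self Real.pi_pos.le
    have : (0:ℝ) ≤ a := by positivity
    linarith
  have := Real.cos_le_cos_of_nonneg_of_le_pi (by positivity) h2 this
  linarith

/-- two branches at a vertex of size at least `m` -/
lemma lam2_two_branches {n : ℕ} (hn : 2 ≤ n) {T : SimpleGraph (Fin n)} (hT : T.IsTree)
    {v w1 w2 : Fin n} (h1 : T.Adj v w1) (h2 : T.Adj v w2) (hne : w1 ≠ w2) {m : ℕ}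
    (c1 : m ≤ (br T v w1).card) (c2 : m ≤ (br T v w2).card) : PP m ≤ lam 2 T := by
  obtain ⟨x, hx⟩ := RV.sidePP hT h1.symm
  obtain ⟨y, hy⟩ := RV.sidePP hT h2.symm
  refine lam2_ge hn T (PP m) 0 0 0 x y hx.ne_zero hy.ne_zero
    (dot_disj hx.supp hy.supp (br_disj hT h1 h2 hne)) le_rfl le_rfl (by norm_num) ?_ ?_
    (cross_zero hT h1 h2 hne hx.supp hy.supp)
  · have := hx.quad
    have := mul_le_mul_of_nonneg_right (PP_mono c1) (dot_pos x hx.ne_zero).le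
    linarith
  · have := hy.quad
    have := mul_le_mul_of_nonneg_right (PP_mono c2) (dot_pos y hy.ne_zero).le
    linarith

lemma lam1_root {n : ℕ} (hn : 2 ≤ n) {T : SimpleGraph (Fin n)} (hT : T.IsTree) {μ : ℝ} {S : ℕ}
    (hg : Good μ S) (v : Fin n) (N : Finset (Fin n)) (hN : N ⊆ nb T v)
    (hS : ∀ w ∈ N, (br T v w).card ≤ S) (h : μ ≤ ∑ w ∈ N, pr μ (br T v w).card) :
    μ ≤ lam 1 T := by
  obtain ⟨x, hx⟩ := RV.exists hT hg.1 v N hN hS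
  refine lam1_ge hn T μ x hx.ne_zero ?_
  have := hx.quad
  linarith

lemma card_le_n {n : ℕ} (B : Finset (Fin n)) : B.card ≤ n := by
  simpa using card_le_univ B

/-- option 1 -/
lemma lam1_double {n : ℕ} (hn : 2 ≤ n) {T : SimpleGraph (Fin n)} (hT : T.IsTree) {μ : ℝ}
    (hμ : 2 ≤ μ) {u v : Fin n} (h : T.Adj u v)
    (hY : μ ≤ YY T μ u v ∨ μ ≤ YY T μ v u ∨ (μ - YY T μ u v) * (μ - YY T μ v u) ≤ 1) :
    μ ≤ lam 1 T := by
  have hg := good_of_two_le hμ n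
  obtain ⟨x, hx⟩ := RV.side hT hg.1 h (fun w _ => card_le_n _)
  obtain ⟨y, hy⟩ := RV.side hT hg.1 h.symm (fun w _ => card_le_n _)
  have qx := hx.quad
  have qy := hy.quad
  by_cases h1 : μ ≤ YY T μ u v
  · exact lam1_ge hn T μ x hx.ne_zero (by linarith)
  by_cases h2 : μ ≤ YY T μ v u
  · exact lam1_ge hn T μ y hy.ne_zero (by linarith)
  have h3 : (μ - YY T μ u v) * (μ - YY T μ v u) ≤ 1 := by tauto
  push Not at h1 h2
  set b := μ - YY T μ v u with hb
  have hbpos : 0 < b := by linarith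
  set t := 1 / b with ht
  have htb : t * b = 1 := by rw [ht]; field_simp
  have htpos : 0 < t := by positivity
  have hxy : x ⬝ᵥ y = 0 := dot_disj hx.supp hy.supp (side_disj hT h)
  have hc : x ⬝ᵥ (adjMat T *ᵥ y) = 1 := by
    rw [cross_one hT h hx.supp hy.supp, hx.root, hy.root, one_mul]
  have hc' : y ⬝ᵥ (adjMat T *ᵥ x) = 1 := by
    rw [cross_one hT h.symm hy.supp hx.supp, hx.root, hy.root, one_mul]
  refine lam1_ge hn T μ (x + t • y) ?_ ?_
  · intro h0
    have := congrFun h0 u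
    have h4 := hy.nonneg u
    have h5 := mul_nonneg htpos.le h4
    simp [hx.root] at this
    linarith
  · simp only [Matrix.mulVec_add, Matrix.mulVec_smul, dotProduct_add, add_dotProduct,
      smul_dotProduct, dotProduct_smul, smul_eq_mul, hxy, dotProduct_comm y x, hc, hc']
    have h6 : t * t * (μ * (y ⬝ᵥ y) + (YY T μ v u - μ)) ≤ t * t * (y ⬝ᵥ (adjMat T *ᵥ y)) :=
      mul_le_mul_of_nonneg_left qy (by positivity)
    have h7 : YY T μ v u - μ = -b := by rw [hb]; ring
    rw [h7] at h6
    have h8 : t * t * b = t := by rw [mul_assoc, htb, mul_one]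
    have h9 : μ - YY T μ u v ≤ t := by
      rw [ht, le_div_iff₀ hbpos]; exact h3
    nlinarith

/-- option 2 -/
lemma lam_sum_double {n : ℕ} (hn : 2 ≤ n) {T : SimpleGraph (Fin n)} (hT : T.IsTree) {μ : ℝ}
    (hμ : 2 ≤ μ) {u v : Fin n} (h : T.Adj u v) (hY : μ ≤ YY T μ u v) :
    μ + PP (br T u v).card ≤ lam 1 T + lam 2 T := by
  have hg := good_of_two_le hμ n
  obtain ⟨x, hx⟩ := RV.side hT hg.1 h (fun w _ => card_le_n _)
  obtain ⟨y, hy⟩ := RV.sidePP hT h.symm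
  have qx := hx.quad
  have qy := hy.quad
  exact lam_sum_ge hn T μ _ x y hx.ne_zero hy.ne_zero
    (dot_disj hx.supp hy.supp (side_disj hT h)) (by linarith) (by linarith)

/-- option 3 -/
lemma lam2_double {n : ℕ} (hn : 2 ≤ n) {T : SimpleGraph (Fin n)} (hT : T.IsTree) {ρ : ℝ} {S : ℕ}
    (hg : Pos ρ S) {u v : Fin n} (h : T.Adj u v)
    (hS : ∀ w ∈ (nb T u).erase v, (br T u w).card ≤ S)
    (hS' : ∀ w ∈ (nb T v).erase u, (br T v w).card ≤ S)
    (h1 : ρ ≤ YY T ρ u v) (h2 : ρ ≤ YY T ρ v u)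
    (h3 : 1 ≤ (YY T ρ u v - ρ) * (YY T ρ v u - ρ)) : ρ ≤ lam 2 T := by
  obtain ⟨x, hx⟩ := RV.side hT hg h hS
  obtain ⟨y, hy⟩ := RV.side hT hg h.symm hS'
  have hc : x ⬝ᵥ (adjMat T *ᵥ y) = 1 := by
    rw [cross_one hT h hx.supp hy.supp, hx.root, hy.root, one_mul]
  exact lam2_ge hn T ρ _ _ 1 x y hx.ne_zero hy.ne_zero
    (dot_disj hx.supp hy.supp (side_disj hT h)) (sub_nonneg.2 h1) (sub_nonneg.2 h2) (by linarith)
    hx.quad hy.quad hc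

lemma nonpath_deg {n : ℕ} (hn : 2 ≤ n) {T : SimpleGraph (Fin n)} (hT : T.IsTree)
    (hiso : ¬ Nonempty (T ≃g SimpleGraph.pathGraph n)) : ∃ v, 3 ≤ (nb T v).card := by
  by_contra hcon
  push Not at hcon
  apply hiso
  have : Nontrivial (Fin n) := by
    obtain ⟨k, rfl⟩ : ∃ k, n = k + 2 := ⟨n - 2, by omega⟩
    infer_instance
  obtain ⟨r, hr⟩ := hT.exists_vert_degree_one_of_nontrivial
  have hr1 : (nb T r).card = 1 := by
    rw [← hr, ← SimpleGraph.card_neighborFinset_eq_degree]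
    congr 1
    ext z; simp [nb]
  have hinj : ∀ k z z', T.dist r z = k → T.dist r z' = k → z = z' := by
    intro k
    induction k with
    | zero =>
      intro z z' h h'
      rw [← hT.connected.dist_eq_zero_iff.1 h, ← hT.connected.dist_eq_zero_iff.1 h']
    | succ k ih =>
      intro z z' h h'
      have hz : r ≠ z := by rintro rfl; simp at h
      have hz' : r ≠ z' := by rintro rfl; simp at h'
      obtain ⟨y, hy, hd⟩ := closer_exists hT hz
      obtain ⟨y', hy', hd'⟩ := closer_exists hT hz'
      have e1 : T.dist r y = k := by rcases dist_adj hT hy r with h | h <;> omega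
      have e2 : T.dist r y' = k := by rcases dist_adj hT hy' r with h | h <;> omega
      have := ih y y' e1 e2
      subst this
      by_cases hyr : r = y
      · subst hyr
        exact card_le_one.1 hr1.le z (mem_nb.2 hy.symm) z' (mem_nb.2 hy'.symm)
      · obtain ⟨t, ht, hdt⟩ := closer_exists hT hyr
        by_contra hne
        have h1 : t ≠ z := by rintro rfl; omega
        have h2 : t ≠ z' := by rintro rfl; omega
        have : ({t, z, z'} : Finset (Fin n)) ⊆ nb T y := by
          intro a ha
          simp only [mem_insert, mem_singleton] at ha
          rcases ha with rfl | rfl | rfl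
          · exact mem_nb.2 ht
          · exact mem_nb.2 hy.symm
          · exact mem_nb.2 hy'.symm
        have hc := card_le_card this
        rw [card_eq_three.2 ⟨t, z, z', h1, h2, hne, rfl⟩] at hc
        have := hcon y
        omega
  have hlt : ∀ z, T.dist r z < n := by
    intro z
    obtain ⟨p, hp, hl⟩ := hT.connected.exists_path_of_dist r z
    have := hp.length_lt
    rw [Fintype.card_fin] at this
    omega
  let f : Fin n → Fin n := fun z => ⟨T.dist r z, hlt z⟩
  have hf : Function.Bijective f := by
    rw [← Finite.injective_iff_bijective]
    intro z z' h
    have : T.dist r z = T.dist r z' := congrArg Fin.val h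
    exact hinj _ z z' rfl this.symm
  refine ⟨⟨Equiv.ofBijective f hf, ?_⟩⟩
  intro a b
  have key : ∀ a b, T.dist r a + 1 = T.dist r b → T.Adj a b := by
    intro a b h
    have hz : r ≠ b := by rintro rfl; simp at h
    obtain ⟨y, hy, hd⟩ := closer_exists hT hz
    have : y = a := hinj _ y a rfl (by rcases dist_adj hT hy r with h | h <;> omega)
    subst this
    exact hy.symm
  rw [SimpleGraph.pathGraph_adj]
  simp only [Equiv.ofBijective_apply, f]
  constructor
  · rintro (h | h)
    · exact key a b h
    · exact (key b a h).symm
  · intro h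
    rcases dist_adj hT h r with h | h <;> omega

lemma lam1_nonpath {n : ℕ} (hn : 5 ≤ n) {T : SimpleGraph (Fin n)} (hT : T.IsTree) {v : Fin n}
    (hv : 3 ≤ (nb T v).card) : 2 * Real.cos (Real.pi / (2 * n - 2)) ≤ lam 1 T := by
  set θ := Real.pi / (2 * (n:ℝ) - 2) with hθ
  have hn' : (5:ℝ) ≤ n := by exact_mod_cast hn
  have hden : (0:ℝ) < 2 * n - 2 := by linarith
  have hθ0 : 0 < θ := div_pos Real.pi_pos hden
  have hθn : (2 * (n:ℝ) - 2) * θ = Real.pi := by rw [hθ, mul_div_cancel₀ _ hden.ne']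
  have hg : Good (2 * Real.cos θ) (2 * n - 4) := by
    apply good_trig hθ0
    rw [← hθn]
    have : ((2 * n - 4 : ℕ) : ℝ) = 2 * n - 4 := by push_cast [show 4 ≤ 2 * n by omega]; ring
    rw [this]; linarith [hθ0]
  set μ := 2 * Real.cos θ with hμ
  have hle : ∀ w ∈ nb T v, (br T v w).card ≤ 2 * n - 4 := by
    intro w hw; have := card_le_n (br T v w); omega
  refine lam1_root (by omega) hT hg v (nb T v) (Subset.refl _) hle ?_
  obtain ⟨w1, w2, w3, h1, h2, h3, h12, h13, h23⟩ := two_lt_card_iff.1 hv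
  have hsum := sum_br hT v
  have e1 : ∀ g : Fin n → ℕ, ∑ w ∈ nb T v, g w = g w1 + (g w2 + ∑ w ∈ ((nb T v).erase w1).erase w2, g w) := by
    intro g
    rw [add_sum_erase _ _ (mem_erase.2 ⟨h12.symm, h2⟩), add_sum_erase _ _ h1]
  have e2 : ∀ g : Fin n → ℝ, ∑ w ∈ nb T v, g w = g w1 + (g w2 + ∑ w ∈ ((nb T v).erase w1).erase w2, g w) := by
    intro g
    rw [add_sum_erase _ _ (mem_erase.2 ⟨h12.symm, h2⟩), add_sum_erase _ _ h1]
  rw [e1] at hsum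
  rw [e2]
  set N := ((nb T v).erase w1).erase w2 with hN
  have hw3 : w3 ∈ N := mem_erase.2 ⟨h23.symm, mem_erase.2 ⟨h13.symm, h3⟩⟩
  have hc3 : 1 ≤ ∑ w ∈ N, (br T v w).card :=
    (br_card_pos (mem_nb.1 h3)).trans
      (single_le_sum (f := fun w => (br T v w).card) (fun _ _ => Nat.zero_le _) hw3)
  have hsub := hg.subadd_sum N (fun w => (br T v w).card) (by omega)
  obtain ⟨a, ha⟩ : ∃ a, (br T v w1).card = 1 + a := ⟨(br T v w1).card - 1, by
    have := br_card_pos (mem_nb.1 h1); omega⟩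
  obtain ⟨b, hb⟩ : ∃ b, (br T v w2).card = 1 + b := ⟨(br T v w2).card - 1, by
    have := br_card_pos (mem_nb.1 h2); omega⟩
  obtain ⟨c, hc⟩ : ∃ c, ∑ w ∈ N, (br T v w).card = 1 + c :=
    ⟨(∑ w ∈ N, (br T v w).card) - 1, by omega⟩
  rw [hc] at hsub hsum
  rw [ha, hb] at hsum ⊢
  have x1 := hg.exch 1 a b (by omega)
  have x2 := hg.exch 1 (a + b) c (by omega)
  have x3 : 1 + (a + b) + c = n - 3 := by omega
  rw [x3] at x2
  rw [← add_assoc] at x2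
  have hcos : 0 < Real.cos θ := by
    apply Real.cos_pos_of_mem_Ioo
    constructor
    · linarith [Real.pi_pos]
    · nlinarith
  have hs : 0 < Real.sin θ := Real.sin_pos_of_pos_of_lt_pi hθ0 (by nlinarith)
  have p1 : pr μ 1 = 1 / (2 * Real.cos θ) := by
    simp [pr, chU_one, chU, hμ]
  have p2 : pr μ (n - 3) = Real.cos (2 * θ) / Real.cos θ := by
    have t1 := chU_trig θ (n - 3)
    have t2 := chU_trig θ (n - 3 + 1)
    have s1 : ((n - 3 : ℕ) : ℝ) * θ = Real.pi / 2 - 2 * θ := by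
      push_cast [show 3 ≤ n by omega]; linarith
    have s2 : ((n - 3 + 1 : ℕ) : ℝ) * θ = Real.pi / 2 - θ := by
      push_cast [show 3 ≤ n by omega]; linarith
    rw [s1, Real.sin_pi_div_two_sub] at t1
    rw [s2, Real.sin_pi_div_two_sub] at t2
    rw [← hμ] at t1 t2
    have u1 : chU μ (n-3) = Real.cos (2*θ) / Real.sin θ := by rw [← t1]; field_simp
    have u2 : chU μ (n-3+1) = Real.cos θ / Real.sin θ := by rw [← t2]; field_simp
    rw [pr, u1, u2]; field_simp
  have fin : 1 / (2 * Real.cos θ) + 1 / (2 * Real.cos θ) + Real.cos (2 * θ) / Real.cos θ = μ := by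
    rw [hμ, Real.cos_two_mul]; field_simp; ring
  rw [p1] at x1 x2
  rw [p2] at x2
  rw [show 1 + a + b = 1 + (a + b) by ring] at x1
  have x4 : 1 + (a + b) = 1 + a + b := by ring
  simp only [x4] at x1 x2
  linarith

/-- some vertex has two branches of size at least `m` -/
def Big {n : ℕ} (T : SimpleGraph (Fin n)) (m : ℕ) : Prop :=
  ∃ v w1 w2, T.Adj v w1 ∧ T.Adj v w2 ∧ w1 ≠ w2 ∧ m ≤ (br T v w1).card ∧ m ≤ (br T v w2).card

lemma exists_m {n : ℕ} {T : SimpleGraph (Fin n)} (h : Big T 1) : ∃ m, 1 ≤ m ∧ Big T m ∧ ¬ Big T (m+1) := by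
  refine ⟨Nat.findGreatest (Big T) n, ?_, ?_, ?_⟩
  · apply Nat.le_findGreatest _ h
    obtain ⟨v, w1, w2, h1, _⟩ := h
    exact (br_card_pos h1).trans (card_le_n _)
  · refine Nat.findGreatest_spec (m := 1) ?_ h
    obtain ⟨v, w1, w2, h1, _⟩ := h
    exact (br_card_pos h1).trans (card_le_n _)
  · intro hb
    have : Nat.findGreatest (Big T) n + 1 ≤ n := by
      obtain ⟨v, w1, w2, h1, _, _, h, _⟩ := hb
      exact h.trans (card_le_n _)
    have := Nat.le_findGreatest this hb
    omega

lemma structure_cases {n : ℕ} (hn : 2 ≤ n) {T : SimpleGraph (Fin n)} (hT : T.IsTree) {m : ℕ} (hb : ¬ Big T (m+1)) :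
    (∃ v, ∀ w ∈ nb T v, (br T v w).card ≤ m) ∨
    ∃ u v, T.Adj u v ∧ m + 1 ≤ (br T u v).card ∧ m + 1 ≤ (br T v u).card ∧
      (∀ w ∈ (nb T u).erase v, (br T u w).card ≤ m) ∧
      (∀ w ∈ (nb T v).erase u, (br T v w).card ≤ m) := by
  by_contra hcon
  push Not at hcon
  obtain ⟨h1, h2⟩ := hcon
  choose f hf hf2 using h1
  obtain ⟨v, _, hv⟩ := exists_min_image univ (fun v => (br T v (f v)).card) ⟨(⟨0, by omega⟩ : Fin n), mem_univ _⟩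
  have hoth : ∀ v w, w ∈ (nb T v).erase (f v) → (br T v w).card ≤ m := by
    intro v w hw
    by_contra hc
    push Not at hc
    exact hb ⟨v, w, f v, mem_nb.1 (mem_of_mem_erase hw), mem_nb.1 (hf v), ne_of_mem_erase hw,
      hc, hf2 v⟩
  have hadj := mem_nb.1 (hf v)
  by_cases hfu : f (f v) = v
  · obtain ⟨w, hw, hw2⟩ := h2 (f v) v hadj.symm (by have := hf2 (f v); rw [hfu] at this; exact this)
      (hf2 v) (by have := hoth (f v); rw [hfu] at this; exact this)
    have := hoth v w hw
    omega
  · have hs := sum_br' hT hadj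
    have hmem : f (f v) ∈ (nb T (f v)).erase v := mem_erase.2 ⟨hfu, hf (f v)⟩
    have := single_le_sum (f := fun w => (br T (f v) w).card) (fun _ _ => Nat.zero_le _) hmem
    have h5 := hv (f v) (mem_univ _)
    omega

/-- rational version of `pr` -/
def qp (μ : ℚ) : ℕ → ℚ
  | 0 => 0
  | s+1 => 1 / (μ - qp μ s)

/-- rational version of `GG` -/
def qG (μ : ℚ) (m α : ℕ) : ℚ := (α / m : ℕ) * qp μ m + qp μ (α % m)

/-- lower bounds for `PP` -/
def qrho (k : ℕ) : ℚ :=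
  if k ≤ 1 then 0 else if k = 2 then 1 else if k = 3 then 1414/1000 else if k = 4 then 1618/1000
  else if k = 5 then 1732/1000 else 2 - 98697/10000/((k+1)*(k+1))

/-- upper bounds for the path value -/
def qC (n : ℕ) : ℚ :=
  if n < 28 then 4 - 49348/1000/((n+1)*(n+1)) + 1726/10/((n+1)*(n+1)*((n+1)*(n+1))) else 4

/-- target for the largest eigenvalue -/
def qmu (c r : ℚ) : ℚ := if c - r ≤ 2 then 2 else c - r

/-- one-vertex test -/
def chkS (μ : ℚ) (m α : ℕ) : Bool := decide (μ ≤ qG μ m α)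

/-- two-vertex test -/
def chkD (μ A B : ℚ) : Bool := decide (μ ≤ A) || decide (μ ≤ B) || decide ((μ - A) * (μ - B) ≤ 1)

lemma two_le_qmu (c r : ℚ) : 2 ≤ qmu c r := by unfold qmu; split_ifs <;> linarith
lemma le_qmu (c r : ℚ) : c ≤ qmu c r + r := by unfold qmu; split_ifs <;> linarith

lemma tabS : ∀ d : Fin 13, ∀ e : Fin 12, 2 * (e.1+1) + 3 ≤ d.1 + 16 →
    chkS (qmu (qC (d.1+16)) (qrho (e.1+1))) (e.1+1) (d.1 + 15) = true := by
  decide +kernel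

lemma tab2 : ∀ d : Fin 13, ∀ e : Fin 3, ∀ b : Fin 14, e.1 + 1 ≤ b.1 → 2 * b.1 ≤ d.1 + 14 →
    chkS (qmu (qC (d.1+16)) (qrho (b.1+1))) (e.1+1) (d.1 + 14 - b.1) = true := by
  decide +kernel

/-- the two-vertex test with parameters -/
def chkDD (N m b : ℕ) (r : ℚ) : Bool :=
  chkD (qmu (qC N) r) (qG (qmu (qC N) r) m (N - 2 - b)) (qG (qmu (qC N) r) m b)

lemma tab1 : ∀ d : Fin 13, ∀ e : Fin 9, ∀ b : Fin 14, e.1 + 4 ≤ b.1 → 2 * b.1 ≤ d.1 + 14 →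
    2 * (e.1+4) + 3 ≤ d.1 + 16 → ¬ (d.1 = 1 ∧ e.1 = 1 ∧ b.1 = 5) →
    ¬ (e.1 = 0 ∧ d.1 < 12 ∧ 6 ≤ b.1) →
    chkDD (d.1+16) (e.1+4) b.1 (qrho (e.1+4)) = true := by
  decide +kernel

lemma tab17 : ∀ d : Fin 12, ∀ b : Fin 14, 6 ≤ b.1 → 2 * b.1 ≤ d.1 + 14 →
    chkDD (d.1+16) 4 b.1 (17/10) = true := by
  decide +kernel

lemma tabA : chkDD 17 5 5 (174/100) = true := by decide +kernel

lemma tabB : qmu (qC 17) (qrho 5) ≤ 9 * (qp (qmu (qC 17) (qrho 5)) 4 / 4) + qp (qmu (qC 17) (qrho 5)) 6 := by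
  decide +kernel

lemma tabB' : ∀ s : Fin 5, qp (qmu (qC 17) (qrho 5)) 4 / 4 * s.1 ≤ qp (qmu (qC 17) (qrho 5)) s.1 := by
  decide +kernel

lemma tabL : qmu 4 (qrho 13) ≤ 2 * qp (qmu 4 (qrho 13)) 13 + qp (qmu 4 (qrho 13)) 2 := by
  decide +kernel

lemma tabL' : chkD (qmu 4 (qrho 13)) (qp (qmu 4 (qrho 13)) 13 + qp (qmu 4 (qrho 13)) 1)
    (qp (qmu 4 (qrho 13)) 13) = true := by
  decide +kernel

lemma pr_succ {μ : ℝ} (hμ : 2 ≤ μ) (s : ℕ) : pr μ (s+1) = 1 / (μ - pr μ s) := by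
  have h := (good_of_two_le hμ (s+1)).rec le_rfl
  have h2 : pr μ (s+1) * (μ - pr μ s) = 1 := by linarith
  exact eq_one_div_of_mul_eq_one_left h2

lemma pr_cast {μ : ℚ} (hμ : 2 ≤ μ) (s : ℕ) : pr (μ:ℝ) s = ((qp μ s : ℚ) : ℝ) := by
  have hμ' : (2:ℝ) ≤ μ := by exact_mod_cast hμ
  induction s with
  | zero => simp [pr_zero, qp]
  | succ s ih => rw [pr_succ hμ', ih, qp]; push_cast; rfl

lemma GG_cast {μ : ℚ} (hμ : 2 ≤ μ) (m α : ℕ) : GG (μ:ℝ) m α = ((qG μ m α : ℚ) : ℝ) := by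
  unfold GG qG
  rw [pr_cast hμ, pr_cast hμ]; push_cast; rfl

lemma pi_sq_lt : Real.pi ^ 2 < 9.8697 := by
  nlinarith [Real.pi_lt_d4, Real.pi_pos]

lemma pi_sq_gt : 9.8696 < Real.pi ^ 2 := by
  nlinarith [Real.pi_gt_d6, Real.pi_pos]

lemma qrho_le_PP {k : ℕ} (hk : 1 ≤ k) : ((qrho k : ℚ) : ℝ) ≤ PP k := by
  unfold qrho
  split_ifs with h1 h2 h3 h4 h5
  · have : k = 1 := by omega
    subst this
    unfold PP
    norm_num
  · subst h2
    unfold PP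
    norm_num
  · subst h3
    unfold PP
    have : Real.pi / ((3:ℕ) + 1 : ℝ) = Real.pi / 4 := by norm_num
    rw [this, Real.cos_pi_div_four]
    have : (1414/1000:ℝ) ≤ √2 := Real.le_sqrt_of_sq_le (by norm_num)
    push_cast; linarith
  · subst h4
    unfold PP
    have : Real.pi / ((4:ℕ) + 1 : ℝ) = Real.pi / 5 := by norm_num
    rw [this, Real.cos_pi_div_five]
    have : (2236/1000:ℝ) ≤ √5 := Real.le_sqrt_of_sq_le (by norm_num)
    push_cast; linarith
  · subst h5
    unfold PP
    have : Real.pi / ((5:ℕ) + 1 : ℝ) = Real.pi / 6 := by norm_num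
    rw [this, Real.cos_pi_div_six]
    have : (1732/1000:ℝ) ≤ √3 := Real.le_sqrt_of_sq_le (by norm_num)
    push_cast; linarith
  · unfold PP
    have h := Real.one_sub_sq_div_two_le_cos (x := Real.pi / (k+1))
    have e : (Real.pi / (k+1)) ^ 2 = Real.pi^2 / (((k:ℝ)+1)*(k+1)) := by
      rw [div_pow, pow_two ((k:ℝ)+1)]
    have h2 : Real.pi^2 / (((k:ℝ)+1)*(k+1)) ≤ (98697/10000) / (((k:ℝ)+1)*(k+1)) := by
      gcongr
      linarith [pi_sq_lt]
    rw [e] at h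
    push_cast
    linarith

lemma path_upper {n : ℕ} (hn : 16 ≤ n) {t : ℝ} (ht : t = Real.pi / (n + 1)) :
    2 * Real.cos t + 2 * Real.cos (2 * t) ≤ 4 - 5 * t^2 + 85/48 * t^4 := by
  have hn' : (16:ℝ) ≤ n := by exact_mod_cast hn
  have h0 : 0 < t := by rw [ht]; positivity
  have h1 : t ≤ 1/4 := by
    rw [ht, div_le_iff₀ (by positivity)]
    linarith [Real.pi_lt_d4]
  have a1 := Real.cos_bound (x := t) (by rw [abs_of_pos h0]; linarith)
  have a2 := Real.cos_bound (x := 2 * t) (by rw [abs_of_pos (by linarith)]; linarith)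
  rw [abs_of_pos h0] at a1
  rw [abs_of_pos (show 0 < 2 * t by linarith)] at a2
  have b1 := (abs_le.1 a1).2
  have b2 := (abs_le.1 a2).2
  nlinarith

lemma path_lt_C {n : ℕ} (hn : 16 ≤ n) {t : ℝ} (ht : t = Real.pi / (n + 1)) :
    2 * Real.cos t + 2 * Real.cos (2 * t) < ((qC (min n 28) : ℚ) : ℝ) := by
  have h := path_upper hn ht
  have hn' : (16:ℝ) ≤ n := by exact_mod_cast hn
  have h0 : 0 < t := by rw [ht]; positivity
  have h1 : t ≤ 1/4 := by
    rw [ht, div_le_iff₀ (by positivity)]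
    linarith [Real.pi_lt_d4]
  unfold qC
  split_ifs with hlt
  · have : min n 28 = n := by omega
    rw [this]
    push_cast
    refine h.trans_lt ?_
    have hs : (0:ℝ) < ((n:ℝ)+1)*(n+1) := by positivity
    have e1 : t^2 = Real.pi^2 / (((n:ℝ)+1)*(n+1)) := by
      rw [ht, div_pow, pow_two ((n:ℝ)+1)]
    have e2 : t^4 = (Real.pi^2)^2 / (((n:ℝ)+1)*(n+1)*((n+1)*(n+1))) := by
      rw [show t^4 = (t^2)^2 by ring, e1, div_pow, pow_two (((n:ℝ)+1)*(n+1))]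
    have f1 : 49348/1000/(((n:ℝ)+1)*(n+1)) < 5 * t^2 := by
      rw [e1, ← mul_div_assoc]
      gcongr
      nlinarith [Real.pi_gt_d6, Real.pi_pos]
    have f2 : 85/48 * t^4 ≤ 1726/10/(((n:ℝ)+1)*(n+1)*((n+1)*(n+1))) := by
      rw [e2, ← mul_div_assoc]
      gcongr
      nlinarith [pi_sq_lt, Real.pi_pos, sq_nonneg Real.pi]
    linarith
  · push_cast
    refine h.trans_lt ?_
    have h2 : t^2 ≤ 1/16 := by nlinarith
    nlinarith [pow_pos h0 2]

lemma case_big {n m : ℕ} (hn : 16 ≤ n) (hm : n ≤ 2 * m + 2) {t : ℝ} (ht : t = Real.pi / (n + 1)) :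
    2 * Real.cos t + 2 * Real.cos (2 * t) < 2 * Real.cos (Real.pi / (2 * n - 2)) + PP m := by
  have h := path_upper hn ht
  have hn' : (16:ℝ) ≤ n := by exact_mod_cast hn
  have hm' : (n:ℝ) ≤ 2 * m + 2 := by exact_mod_cast hm
  have h0 : 0 < t := by rw [ht]; positivity
  have hpi : Real.pi = t * (n+1) := by rw [ht]; field_simp
  have h1 : t ≤ 0.185 := by
    rw [ht, div_le_iff₀ (by positivity)]
    linarith [Real.pi_lt_d4]
  unfold PP
  have a1 := Real.one_sub_sq_div_two_le_cos (x := Real.pi / (2 * n - 2))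
  have a2 := Real.one_sub_sq_div_two_le_cos (x := Real.pi / (m + 1))
  have b1 : Real.pi / (2 * n - 2) ≤ 17/30 * t := by
    rw [div_le_iff₀ (by linarith), hpi]; nlinarith
  have b2 : Real.pi / (m + 1) ≤ 17/8 * t := by
    rw [div_le_iff₀ (by positivity), hpi]; nlinarith
  have c1 : (Real.pi / (2 * n - 2))^2 ≤ (17/30 * t)^2 := by
    apply pow_le_pow_left₀ _ b1
    apply div_nonneg Real.pi_pos.le; linarith
  have c2 : (Real.pi / (m + 1))^2 ≤ (17/8 * t)^2 := by
    apply pow_le_pow_left₀ _ b2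
    positivity
  have d : t^4 ≤ 0.0343 * t^2 := by
    have : t^2 ≤ 0.0343 := by nlinarith
    nlinarith [sq_nonneg t]
  nlinarith [pow_pos h0 2]

lemma YY_ge {n : ℕ} {T : SimpleGraph (Fin n)} (hT : T.IsTree) {μ : ℝ} (hμ : 2 ≤ μ) {m a : ℕ}
    (hm : 1 ≤ m) {u v : Fin n} (h : T.Adj u v) (hf : ∀ w ∈ (nb T u).erase v, (br T u w).card ≤ m)
    (ha : a + 1 ≤ (br T v u).card) : GG μ m a ≤ YY T μ u v := by
  have hs := sum_br' hT h.symm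
  have h1 := GG_sum hμ hm ((nb T u).erase v) (fun w => (br T u w).card) hf
  exact (GG_mono hμ hm (by omega)).trans h1

lemma double_of {μ A B a b : ℝ} (hA : A ≤ a) (hB : B ≤ b)
    (h : μ ≤ A ∨ μ ≤ B ∨ (μ - A) * (μ - B) ≤ 1) :
    μ ≤ a ∨ μ ≤ b ∨ (μ - a) * (μ - b) ≤ 1 := by
  by_cases h1 : μ ≤ a
  · exact Or.inl h1
  by_cases h2 : μ ≤ b
  · exact Or.inr (Or.inl h2)
  push Not at h1 h2
  refine Or.inr (Or.inr ?_)
  rcases h with h | h | h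
  · linarith
  · linarith
  · refine le_trans ?_ h
    apply mul_le_mul <;> linarith

lemma chkD_cast {μ A B : ℚ} (h : chkD μ A B = true) :
    (μ:ℝ) ≤ A ∨ (μ:ℝ) ≤ B ∨ ((μ:ℝ) - A) * (μ - B) ≤ 1 := by
  simp only [chkD, Bool.or_eq_true, decide_eq_true_eq] at h
  rcases h with (h | h) | h
  · left; exact_mod_cast h
  · right; left; exact_mod_cast h
  · right; right; exact_mod_cast h

lemma lin_sum {n : ℕ} {T : SimpleGraph (Fin n)} (ρ κ : ℝ) (u : Fin n) (N : Finset (Fin n))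
    (h : ∀ w ∈ N, κ * (br T u w).card ≤ pr ρ (br T u w).card) :
    κ * ((∑ w ∈ N, (br T u w).card : ℕ) : ℝ) ≤ ∑ w ∈ N, pr ρ (br T u w).card := by
  push_cast
  rw [mul_sum]
  exact sum_le_sum h

lemma pos17 : Pos 1.7 4 := by
  intro k h1 h2
  interval_cases k <;> norm_num [chU]

lemma pos174 : Pos 1.74 5 := by
  intro k h1 h2
  interval_cases k <;> norm_num [chU]

lemma lin17 (s : ℕ) (hs : s ≤ 4) : 0.416 * (s:ℝ) ≤ pr 1.7 s := by
  interval_cases s <;> norm_num [pr, chU]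

lemma lin174 (s : ℕ) (hs : s ≤ 5) : 0.377 * (s:ℝ) ≤ pr 1.74 s := by
  interval_cases s <;> norm_num [pr, chU]

lemma p5_174 : 11 ≤ pr 1.74 5 := by
  norm_num [pr, chU]

lemma case_ii {n : ℕ} (hn : 16 ≤ n) {T : SimpleGraph (Fin n)} (hT : T.IsTree) {m : ℕ}
    (hm : 1 ≤ m) (hmn : 2 * m + 3 ≤ n) (hl2 : PP m ≤ lam 2 T)
    (h : ∃ v, ∀ w ∈ nb T v, (br T v w).card ≤ m) :
    ((qC (min n 28) : ℚ) : ℝ) ≤ lam 1 T + lam 2 T := by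
  obtain ⟨v, hv⟩ := h
  have hsum := sum_br hT v
  have key : ∀ μ : ℚ, 2 ≤ μ → ∀ a, a + 1 ≤ n → (μ:ℝ) ≤ GG (μ:ℝ) m a → (μ:ℝ) ≤ lam 1 T := by
    intro μ hμ a ha hG
    have hμ' : (2:ℝ) ≤ μ := by exact_mod_cast hμ
    refine lam1_root (by omega) hT (good_of_two_le hμ' n) v (nb T v) (Subset.refl _)
      (fun w _ => card_le_n _) ?_
    exact hG.trans ((GG_mono hμ' hm (by omega)).trans
      (GG_sum hμ' hm (nb T v) (fun w => (br T v w).card) hv))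
  rcases Nat.lt_or_ge m 13 with h12 | h13
  · obtain ⟨d, hd⟩ : ∃ d, min n 28 = d + 16 := ⟨min n 28 - 16, by omega⟩
    have ht := tabS ⟨d, by omega⟩ ⟨m - 1, by omega⟩ (by simp only; omega)
    simp only [show m - 1 + 1 = m by omega] at ht
    rw [hd]
    set μ := qmu (qC (d+16)) (qrho m) with hμ
    have h2 : 2 ≤ μ := two_le_qmu _ _
    have hl1 := key μ h2 (d+15) (by omega) (by
      rw [GG_cast h2]
      simp only [chkS, decide_eq_true_eq] at ht
      exact_mod_cast ht)
    have h3 : ((qC (d+16) : ℚ):ℝ) ≤ μ + qrho m := by exact_mod_cast le_qmu _ _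
    have := qrho_le_PP hm
    linarith
  · have hC : qC (min n 28) = 4 := by
      rw [show min n 28 = 28 by omega]; simp [qC]
    rw [hC]
    set μ := qmu 4 (qrho 13) with hμ
    have h2 : 2 ≤ μ := two_le_qmu _ _
    have h2' : (2:ℝ) ≤ μ := by exact_mod_cast h2
    have hg := good_of_two_le h2' m
    have hl1 := key μ h2 (m * 2 + 2) (by omega) (by
      unfold GG
      rw [Nat.mul_add_div (by omega), Nat.mul_add_mod, Nat.div_eq_of_lt (by omega),
        Nat.mod_eq_of_lt (by omega)]
      have h3 := hg.mono h13 le_rfl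
      rw [pr_cast h2 13] at h3
      rw [pr_cast h2 2]
      have h4 : ((μ : ℚ) : ℝ) ≤ ((2 * qp μ 13 + qp μ 2 : ℚ) : ℝ) := by exact_mod_cast tabL
      push_cast at h4 ⊢
      linarith)
    have h3 : ((4 : ℚ):ℝ) ≤ μ + qrho 13 := by exact_mod_cast le_qmu _ _
    have := qrho_le_PP (k := 13) (by norm_num)
    have := PP_mono h13
    linarith

lemma use_DD {n : ℕ} (hn : 16 ≤ n) {T : SimpleGraph (Fin n)} (hT : T.IsTree) {m : ℕ}
    (hm : 1 ≤ m) {u v : Fin n} (h : T.Adj u v)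
    (hu : ∀ w ∈ (nb T u).erase v, (br T u w).card ≤ m)
    (hv : ∀ w ∈ (nb T v).erase u, (br T v w).card ≤ m) {N b : ℕ}
    (hb : b + 1 ≤ (br T u v).card) (ha : N - 2 - b + 1 ≤ (br T v u).card) (r : ℚ)
    (ht : chkDD N m b r = true) (hr : (r:ℝ) ≤ lam 2 T) :
    ((qC N : ℚ) : ℝ) ≤ lam 1 T + lam 2 T := by
  unfold chkDD at ht
  set μ := qmu (qC N) r with hμ
  have h2 : 2 ≤ μ := two_le_qmu _ _
  have h2' : (2:ℝ) ≤ μ := by exact_mod_cast h2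
  have h3 : ((qC N : ℚ):ℝ) ≤ μ + r := by exact_mod_cast le_qmu _ _
  have hl1 := lam1_double (by omega) hT h2' h (double_of
    (by rw [← GG_cast h2]; exact YY_ge hT h2' hm h hu ha)
    (by rw [← GG_cast h2]; exact YY_ge hT h2' hm h.symm hv hb) (chkD_cast ht))
  linarith

lemma case_iii {n : ℕ} (hn : 16 ≤ n) {T : SimpleGraph (Fin n)} (hT : T.IsTree) {m : ℕ}
    (hm : 1 ≤ m) (hmn : 2 * m + 3 ≤ n) (hl2 : PP m ≤ lam 2 T) {u v : Fin n} (h : T.Adj u v)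
    (h1 : m + 1 ≤ (br T u v).card) (hle : (br T u v).card ≤ (br T v u).card)
    (hu : ∀ w ∈ (nb T u).erase v, (br T u w).card ≤ m)
    (hv : ∀ w ∈ (nb T v).erase u, (br T v w).card ≤ m) :
    ((qC (min n 28) : ℚ) : ℝ) ≤ lam 1 T + lam 2 T := by
  have hadd := br_card_add hT h
  have hsu := sum_br' hT h.symm
  have hsv := sum_br' hT h
  have hrho := qrho_le_PP hm
  rcases Nat.lt_or_ge m 13 with h12 | h13
  · obtain ⟨d, hd⟩ : ∃ d, min n 28 = d + 16 := ⟨min n 28 - 16, by omega⟩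
    obtain ⟨b, hb⟩ : ∃ b, b = min ((br T u v).card - 1) 13 := ⟨_, rfl⟩
    have hbm : m ≤ b := by omega
    have hb2 : 2 * b ≤ d + 14 := by omega
    have hb1 : b + 1 ≤ (br T u v).card := by omega
    have ha1 : d + 14 - b + 1 ≤ (br T v u).card := by omega
    rw [hd]
    rcases Nat.lt_or_ge m 4 with h3 | h4
    · -- option 2
      have ht := tab2 ⟨d, by omega⟩ ⟨m - 1, by omega⟩ ⟨b, by omega⟩ (by simp only; omega) hb2
      simp only [show m - 1 + 1 = m by omega] at ht
      set μ := qmu (qC (d+16)) (qrho (b+1)) with hμ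
      have h2 : 2 ≤ μ := two_le_qmu _ _
      have h2' : (2:ℝ) ≤ μ := by exact_mod_cast h2
      have h3 : ((qC (d+16) : ℚ):ℝ) ≤ μ + qrho (b+1) := by exact_mod_cast le_qmu _ _
      have hG := YY_ge hT h2' hm h hu ha1
      rw [GG_cast h2] at hG
      simp only [chkS, decide_eq_true_eq] at ht
      have ht' : (μ:ℝ) ≤ ((qG μ m (d+14-b) : ℚ):ℝ) := by exact_mod_cast ht
      have := lam_sum_double (by omega) hT h2' h (ht'.trans hG)
      have := qrho_le_PP (k := b+1) (by omega)
      have := PP_mono hb1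
      linarith
    · by_cases h17 : m = 4 ∧ d < 12 ∧ 6 ≤ b
      · obtain ⟨rfl, hd12, hb6⟩ := h17
        have ht := tab17 ⟨d, hd12⟩ ⟨b, by omega⟩ hb6 hb2
        refine use_DD hn hT hm h hu hv hb1 (by omega) _ ht ?_
        have y1 := lin_sum (T := T) 1.7 0.416 u ((nb T u).erase v) (fun w hw => lin17 _ (hu w hw))
        have y2 := lin_sum (T := T) 1.7 0.416 v ((nb T v).erase u) (fun w hw => lin17 _ (hv w hw))
        obtain ⟨β, hβ⟩ : ∃ β, β = ∑ w ∈ (nb T v).erase u, (br T v w).card := ⟨_, rfl⟩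
        obtain ⟨α, hα⟩ : ∃ α, α = ∑ w ∈ (nb T u).erase v, (br T u w).card := ⟨_, rfl⟩
        rw [← hα] at y1 hsu
        rw [← hβ] at y2 hsv
        have hαβ : 14 ≤ α + β := by omega
        have hβ6 : 6 ≤ β := by omega
        have hα7 : 7 ≤ α := by omega
        have z1 : (14:ℝ) ≤ α + β := by exact_mod_cast hαβ
        have z2 : (6:ℝ) ≤ β := by exact_mod_cast hβ6
        have z3 : (7:ℝ) ≤ α := by exact_mod_cast hα7
        have e : (((17/10 : ℚ) : ℚ) : ℝ) = 1.7 := by norm_num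
        rw [e]
        have g1 : (0.416 * (α:ℝ) - 1.7) ≤ YY T 1.7 u v - 1.7 := by unfold YY; linarith
        have g2 : (0.416 * (β:ℝ) - 1.7) ≤ YY T 1.7 v u - 1.7 := by unfold YY; linarith
        refine lam2_double (by omega) hT pos17 h hu hv (by linarith) (by linarith) ?_
        have g3 : (0.416 * (α:ℝ) - 1.7) * (0.416 * (β:ℝ) - 1.7) ≤
            (YY T 1.7 u v - 1.7) * (YY T 1.7 v u - 1.7) :=
          mul_le_mul g1 g2 (by linarith) (by linarith)
        refine le_trans ?_ g3
        rcases Nat.lt_or_ge β 7 with hb7 | hb7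
        · have : (8:ℝ) ≤ α := by
            have : 8 ≤ α := by omega
            exact_mod_cast this
          nlinarith
        · have : (7:ℝ) ≤ β := by exact_mod_cast hb7
          nlinarith
      · by_cases hex : d = 1 ∧ m = 5 ∧ b = 5
        · obtain ⟨rfl, rfl, rfl⟩ := hex
          have hn17 : n = 17 := by omega
          have hv6 : (br T u v).card = 6 := by omega
          have hu11 : (br T v u).card = 11 := by omega
          by_cases htwo : ∃ w1 w2, w1 ∈ (nb T u).erase v ∧ w2 ∈ (nb T u).erase v ∧ w1 ≠ w2 ∧
              (br T u w1).card = 5 ∧ (br T u w2).card = 5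
          · obtain ⟨w1, w2, m1, m2, hne, c1, c2⟩ := htwo
            refine use_DD hn hT hm h hu hv hb1 (by omega) _ tabA ?_
            have e : (((174/100 : ℚ) : ℚ) : ℝ) = 1.74 := by norm_num
            rw [e]
            have y2 := lin_sum (T := T) 1.74 0.377 v ((nb T v).erase u) (fun w hw => lin174 _ (hv w hw))
            have e2 : ∑ w ∈ (nb T v).erase u, (br T v w).card = 5 := by omega
            rw [e2] at y2
            have y1 : (22:ℝ) ≤ YY T 1.74 u v := by
              have hsub : ({w1, w2} : Finset (Fin n)) ⊆ (nb T u).erase v := by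
                intro a ha
                simp only [mem_insert, mem_singleton] at ha
                rcases ha with rfl | rfl
                · exact m1
                · exact m2
              have := sum_le_sum_of_subset_of_nonneg (f := fun w => pr 1.74 (br T u w).card) hsub
                (fun w hw _ => pos174.pr_nonneg (hu w hw))
              rw [sum_pair hne, c1, c2] at this
              have := p5_174
              unfold YY
              linarith
            have y2' : (1.885:ℝ) ≤ YY T 1.74 v u := by
              unfold YY
              push_cast at y2
              linarith
            refine lam2_double (by omega) hT pos174 h hu hv (by linarith) (by linarith) ?_
            nlinarith
          · have hr5 := hrho
            set μ := qmu (qC (1+16)) (qrho 5) with hμ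
            have h2 : 2 ≤ μ := two_le_qmu _ _
            have h2' : (2:ℝ) ≤ μ := by exact_mod_cast h2
            have h3 : ((qC (1+16) : ℚ):ℝ) ≤ μ + qrho 5 := by exact_mod_cast le_qmu _ _
            have hl : ∀ s ≤ 4, ((qp μ 4 / 4 : ℚ) : ℝ) * s ≤ pr (μ:ℝ) s := by
              intro s hs
              rw [pr_cast h2]
              exact_mod_cast tabB' ⟨s, by omega⟩
            have hκ : (0:ℝ) ≤ ((qp μ 4 / 4 : ℚ) : ℝ) := by
              push_cast
              rw [← pr_cast h2]
              have := (good_of_two_le h2' 4).pr_nonneg (s := 4) le_rfl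
              linarith
            have h5 : ((qp μ 4 / 4 : ℚ) : ℝ) * 4 ≤ pr (μ:ℝ) 5 := by
              have := hl 4 le_rfl
              have h6 := (good_of_two_le h2' 5).mono (a := 4) (b := 5) (by norm_num) le_rfl
              push_cast at this ⊢
              linarith
            set κ : ℝ := ((qp μ 4 / 4 : ℚ) : ℝ) with hκdef
            have hYA : 9 * κ ≤ YY T μ u v := by
              unfold YY
              have e2 : ∑ w ∈ (nb T u).erase v, (br T u w).card = 10 := by omega
              by_cases hone : ∃ w1 ∈ (nb T u).erase v, (br T u w1).card = 5
              · obtain ⟨w1, m1, c1⟩ := hone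
                have hrest : ∀ w ∈ ((nb T u).erase v).erase w1, (br T u w).card ≤ 4 := by
                  intro w hw
                  have k1 := hu w (mem_of_mem_erase hw)
                  by_contra hc
                  exact htwo ⟨w1, w, m1, mem_of_mem_erase hw, (ne_of_mem_erase hw).symm, c1, by omega⟩
                have y1 := lin_sum (T := T) μ κ u (((nb T u).erase v).erase w1)
                  (fun w hw => hl _ (hrest w hw))
                rw [← add_sum_erase _ _ m1] at e2 ⊢
                have e3 : ∑ w ∈ ((nb T u).erase v).erase w1, (br T u w).card = 5 := by omega
                rw [e3] at y1
                rw [c1]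
                push_cast at y1
                linarith
              · have y1 := lin_sum (T := T) μ κ u ((nb T u).erase v) (fun w hw => hl _ (by
                  have k1 := hu w hw
                  by_contra hc
                  exact hone ⟨w, hw, by omega⟩))
                rw [e2] at y1
                push_cast at y1
                linarith
            have hYB : pr (μ:ℝ) 5 ≤ YY T μ v u := by
              have := YY_ge hT h2' hm h.symm hv hb1
              unfold GG at this
              norm_num [pr_zero] at this
              exact this
            have hB : (μ:ℝ) ≤ 9 * κ + pr (μ:ℝ) 6 := by
              rw [pr_cast h2, hκdef]
              have hB0 : μ ≤ 9 * (qp μ 4 / 4) + qp μ 6 := tabB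
              exact_mod_cast hB0
            have hgr := (good_of_two_le h2' 6).rec (s := 5) (by norm_num)
            have hp6 := (good_of_two_le h2' 6).pr_pos (s := 6) le_rfl (by norm_num)
            have hl1 := lam1_double (by omega) hT h2' h (double_of hYA hYB (by
              right; right
              have hpos : 0 < (μ:ℝ) - pr (μ:ℝ) 5 := by
                by_contra hc
                push Not at hc
                nlinarith
              nlinarith))
            linarith
        · have ht := tab1 ⟨d, by omega⟩ ⟨m - 4, by omega⟩ ⟨b, by omega⟩ (by simp only; omega) hb2
            (by simp only; omega) (by simp only; omega) (by simp only; omega)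
          simp only [show m - 4 + 4 = m by omega] at ht
          exact use_DD hn hT hm h hu hv hb1 (by omega) _ ht (hrho.trans hl2)
  · have hC : qC (min n 28) = 4 := by
      rw [show min n 28 = 28 by omega]; simp [qC]
    rw [hC]
    set μ := qmu 4 (qrho 13) with hμ
    have h2 : 2 ≤ μ := two_le_qmu _ _
    have h2' : (2:ℝ) ≤ μ := by exact_mod_cast h2
    have h3 : ((4 : ℚ):ℝ) ≤ μ + qrho 13 := by exact_mod_cast le_qmu _ _
    have hr13 := qrho_le_PP (k := 13) (by norm_num)
    have hpp := PP_mono h13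
    have h13' := (good_of_two_le h2' m).mono h13 le_rfl
    have hYA := YY_ge (a := m * 1 + 1) hT h2' hm h hu (by omega)
    have hYB := YY_ge (a := m * 1 + 0) hT h2' hm h.symm hv (by omega)
    unfold GG at hYA hYB
    rw [Nat.mul_add_div (by omega), Nat.mul_add_mod, Nat.div_eq_of_lt (by omega),
        Nat.mod_eq_of_lt (by omega)] at hYA hYB
    rw [pr_zero] at hYB
    have hl1 := lam1_double (by omega) hT h2' h (double_of
      (A := ((qp μ 13 + qp μ 1 : ℚ):ℝ)) (B := ((qp μ 13 : ℚ):ℝ))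
      (by push_cast at hYA ⊢; rw [← pr_cast h2, ← pr_cast h2]; linarith)
      (by push_cast at hYB ⊢; rw [← pr_cast h2]; linarith) (chkD_cast tabL'))
    linarith

/-- For every `n ≥ 16`, the path `Pₙ` is the unique minimizer of `λ₁ + λ₂`
among trees on `n` vertices. -/
theorem spectral_sum_min_trees (n : ℕ) (hn : 16 ≤ n)
    (T : SimpleGraph (Fin n)) (hT : T.IsTree)
    (hiso : ¬ Nonempty (T ≃g SimpleGraph.pathGraph n)) :
    lam 1 T + lam 2 T >
      lam 1 (SimpleGraph.pathGraph n) + lam 2 (SimpleGraph.pathGraph n) := by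
  obtain ⟨v, hv⟩ := nonpath_deg (by omega) hT hiso
  have hl1 := lam1_nonpath (by omega) hT hv
  have hb1 : Big T 1 := by
    obtain ⟨w1, w2, w3, h1, h2, h3, h12, _⟩ := two_lt_card_iff.1 hv
    exact ⟨v, w1, w2, mem_nb.1 h1, mem_nb.1 h2, h12, br_card_pos (mem_nb.1 h1),
      br_card_pos (mem_nb.1 h2)⟩
  obtain ⟨m, hm, hbm, hbm'⟩ := exists_m hb1
  have hl2 : PP m ≤ lam 2 T := by
    obtain ⟨v, w1, w2, h1, h2, h12, c1, c2⟩ := hbm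
    exact lam2_two_branches (by omega) hT h1 h2 h12 c1 c2
  obtain ⟨t, ht⟩ : ∃ t : ℝ, t = Real.pi / (n + 1) := ⟨_, rfl⟩
  have e1 : lam 1 (SimpleGraph.pathGraph n) = 2 * Real.cos t := by
    rw [path_lam n 1 le_rfl (by omega), ht]; norm_num
  have e2 : lam 2 (SimpleGraph.pathGraph n) = 2 * Real.cos (2 * t) := by
    rw [path_lam n 2 (by norm_num) (by omega), ht]; norm_num [mul_div_assoc]
  rw [e1, e2, gt_iff_lt]
  rcases Nat.lt_or_ge (2 * m + 2) n with hlt | hge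
  · refine (path_lt_C hn ht).trans_le ?_
    rcases structure_cases (by omega) hT hbm' with hii | ⟨u, v, h, c1, c2, hu, hv⟩
    · exact case_ii hn hT hm hlt hl2 hii
    · rcases le_total (br T u v).card (br T v u).card with hle | hle
      · exact case_iii hn hT hm hlt hl2 h c1 hle hu hv
      · exact case_iii hn hT hm hlt hl2 h.symm c2 hle hv hu
  · have := case_big hn hge ht
    linarith
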